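/- Let e ≥ 2, r' ≥ 1 and l ≥ 1 be integers. The images in the l-wedge space Λ^l_{e,r'} of the ordered wedges |t_1⟩∧…∧|t_l⟩ (with t_1 > t_2 > … > t_l) form a basis of Λ^l_{e,r'} as a ℚ(q)-vector space: they span Λ^l_{e,r'} and are linearly independent. -/

import Mathlib

noncomputable section

/-- The field `ℚ(q)` of rational functions. -/
abbrev K : Type := RatFunc ℚ

/-- The element `q` of `ℚ(q)`. -/
def qK : K := RatFunc.X

/-- `a_{r'}(t)`: the unique element of `{1,…,e}` congruent to `t` modulo `e`
(this does not depend on `r'`). -/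
def aFun (e t : ℤ) : ℤ := (t - 1) % e + 1

/-- `b_{r'}(t)`: the unique element of `{1,…,r'}` such that
`t = a_{r'}(t) + e (b_{r'}(t) − 1) − e r' m` for some integer `m`. -/
def bFun (e r t : ℤ) : ℤ := (t - 1) % (e * r) / e + 1

/-- `m_{r'}(t)`: the unique integer with
`t = a_{r'}(t) + e (b_{r'}(t) − 1) − e r' m_{r'}(t)`. -/
def mFun (e r t : ℤ) : ℤ := (aFun e t + e * (bFun e r t - 1) - t) / (e * r)

/-- The free `ℚ(q)`-module on the set of `l`-tuples of integers
(the basis element at `(t₁,…,t_l)` is the formal wedge `|t₁⟩∧…∧|t_l⟩`). -/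
abbrev FW (l : ℕ) := (Fin l → ℤ) →₀ K

/-- The formal two-entry wedge `|x⟩∧|y⟩` in the free module on pairs. -/
def pairTerm (x y : ℤ) : (ℤ × ℤ) →₀ K := Finsupp.single (x, y) 1

/-- The sum `Σ_{m ≥ m0} coeff m · |u−γ−Nm⟩∧|t+γ+Nm⟩`, where `m` ranges only over those
values for which the displayed wedge is ordered (first entry strictly bigger).  Since
`N ≥ 2` and `γ ≥ 0` in all uses, all such `m` satisfy `m ≤ (u−t).toNat`, so the
following finite sum captures all of them. -/
def pairSum (N t u γ : ℤ) (m0 : ℕ) (coeff : ℕ → K) : (ℤ × ℤ) →₀ K :=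
  ∑ m ∈ Finset.Ico m0 ((u - t).toNat + 1),
    if t + γ + N * m < u - γ - N * m then coeff m • pairTerm (u - γ - N * m) (t + γ + N * m)
    else 0

/-- For `t ≤ u`, the right-hand side of the straightening relation for `|t⟩∧|u⟩`
in the wedge space with parameters `e, r`. -/
def pairRHS (e r t u : ℤ) : (ℤ × ℤ) →₀ K :=
  let N := e * r
  let α := (aFun e u - aFun e t) % N
  let β := (e * (bFun e r u - bFun e r t)) % N
  if α = 0 ∧ β = 0 then -pairTerm u t
  else if β = 0 then
    -(qK⁻¹ • pairTerm u t) +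
      (qK ^ (-2 : ℤ) - 1) •
        (pairSum N t u α 0 (fun m => qK ^ (-2 * (m : ℤ))) -
          pairSum N t u 0 1 (fun m => qK ^ (1 - 2 * (m : ℤ))))
  else if α = 0 then
    -(qK • pairTerm u t) +
      (qK ^ (2 : ℤ) - 1) •
        (pairSum N t u β 0 (fun m => qK ^ (2 * (m : ℤ))) -
          pairSum N t u 0 1 (fun m => qK ^ (2 * (m : ℤ) - 1)))
  else
    -pairTerm u t +
      (qK - qK⁻¹) • pairSum N t u β 0
        (fun m => (qK ^ (2 * (m : ℤ) + 1) + qK ^ (-2 * (m : ℤ) - 1)) / (qK + qK⁻¹)) +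
      (qK⁻¹ - qK) • pairSum N t u α 0
        (fun m => (qK ^ (2 * (m : ℤ) + 1) + qK ^ (-2 * (m : ℤ) - 1)) / (qK + qK⁻¹)) +
      (qK - qK⁻¹) • pairSum N t u (α + β) 0
        (fun m => (qK ^ (2 * (m : ℤ) + 2) - qK ^ (-2 * (m : ℤ) - 2)) / (qK + qK⁻¹)) +
      (qK⁻¹ - qK) • pairSum N t u 0 1
        (fun m => (qK ^ (2 * (m : ℤ)) - qK ^ (-2 * (m : ℤ))) / (qK + qK⁻¹))

/-- Replace the entries of an `l`-tuple at positions `j` and `j+1` by `p.1` and `p.2`. -/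
def updPair (l : ℕ) (ts : Fin l → ℤ) (j : ℕ) (p : ℤ × ℤ) : Fin l → ℤ :=
  fun i => if (i : ℕ) = j then p.1 else if (i : ℕ) = j + 1 then p.2 else ts i

/-- The set of straightening relators: for every `l`-tuple `ts` and every pair of
adjacent positions `j, j+1` with `ts j ≤ ts (j+1)`, the element
`|ts⟩ − (RHS of the straightening relation applied at positions j, j+1)`. -/
def relSet (e r : ℤ) (l : ℕ) : Set (FW l) :=
  {x | ∃ (ts : Fin l → ℤ) (j j' : Fin l), (j' : ℕ) = (j : ℕ) + 1 ∧ ts j ≤ ts j' ∧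
      x = Finsupp.single ts 1 -
        (pairRHS e r (ts j) (ts j')).sum fun p c => Finsupp.single (updPair l ts (j : ℕ) p) c}

/-- The `l`-wedge space `Λ^l_{e,r}`: the quotient of the free module on `l`-tuples by
the straightening relations. -/
abbrev WedgeSpace (e r : ℤ) (l : ℕ) := FW l ⧸ Submodule.span K (relSet e r l)

/-- The image of the wedge `|ts 0⟩∧…∧|ts (l−1)⟩` in the `l`-wedge space. -/
def wedge (e r : ℤ) (l : ℕ) (ts : Fin l → ℤ) : WedgeSpace e r l :=
  Submodule.Quotient.mk (Finsupp.single ts 1)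

section SymmetrizerRing

variable {R : Type*} [Ring R]

/-- The partial symmetrizer `1 + S_{k-1} + S_{k-2} S_{k-1} + ⋯ + S_0 ⋯ S_{k-1}`. -/
def cosetSum (S : ℕ → R) : ℕ → R
  | 0 => 1
  | k + 1 => 1 + cosetSum S k * S k

/-- The symmetrizer attached to `S_0, …, S_{n-2}`, the sum of all the `S_w`, `w` a permutation
of `n` letters. -/
def symmetrizer (S : ℕ → R) : ℕ → R
  | 0 => 1
  | k + 1 => cosetSum S k * symmetrizer S k

lemma cosetSum_zero (S : ℕ → R) : cosetSum S 0 = 1 := rfl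

lemma cosetSum_succ (S : ℕ → R) (k : ℕ) :
    cosetSum S (k + 1) = 1 + cosetSum S k * S k := rfl

lemma symmetrizer_zero (S : ℕ → R) : symmetrizer S 0 = 1 := rfl

lemma symmetrizer_succ (S : ℕ → R) (k : ℕ) :
    symmetrizer S (k + 1) = cosetSum S k * symmetrizer S k := rfl

variable {S : ℕ → R}

lemma commute_cosetSum (hc : ∀ i j, i + 2 ≤ j → Commute (S i) (S j)) {k j : ℕ}
    (h : k + 1 ≤ j) : Commute (cosetSum S k) (S j) := by
  induction k with
  | zero => exact Commute.one_left _
  | succ k ih =>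
    exact (Commute.one_left _).add_left ((ih (by omega)).mul_left (hc _ _ (by omega)))

lemma commute_symmetrizer (hc : ∀ i j, i + 2 ≤ j → Commute (S i) (S j)) {k j : ℕ}
    (h : k ≤ j) : Commute (symmetrizer S k) (S j) := by
  induction k with
  | zero => exact Commute.one_left _
  | succ k ih => exact (commute_cosetSum hc (by omega)).mul_left (ih (by omega))

lemma cosetSum_mul_cosetSum (hc : ∀ i j, i + 2 ≤ j → Commute (S i) (S j))
    (hb : ∀ i, S i * S (i + 1) * S i = S (i + 1) * S i * S (i + 1)) (k : ℕ) :
    ∃ Y, cosetSum S (k + 1) * cosetSum S k = Y * (1 + S k) := by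
  induction k with
  | zero => exact ⟨1, by simp [cosetSum]⟩
  | succ k ih =>
    obtain ⟨Y, hY⟩ := ih
    refine ⟨cosetSum S (k + 1) + Y * (S (k + 1) * S k), ?_⟩
    have h1 : cosetSum S (k + 1 + 1) = 1 + cosetSum S (k + 1) * S (k + 1) := rfl
    have h2 : cosetSum S (k + 1) = 1 + cosetSum S k * S k := rfl
    have h3 := (commute_cosetSum hc (le_refl (k + 1))).eq
    calc cosetSum S (k + 1 + 1) * cosetSum S (k + 1)
        = cosetSum S (k + 1) + cosetSum S (k + 1) * S (k + 1) * (1 + cosetSum S k * S k) := by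
          rw [← h2, h1, add_mul, one_mul]
      _ = cosetSum S (k + 1) * (1 + S (k + 1))
            + cosetSum S (k + 1) * (S (k + 1) * cosetSum S k) * S k := by noncomm_ring
      _ = cosetSum S (k + 1) * (1 + S (k + 1)) + Y * (1 + S k) * S (k + 1) * S k := by
          rw [← h3, ← mul_assoc, hY]
      _ = cosetSum S (k + 1) * (1 + S (k + 1))
            + Y * (S (k + 1) * S k + S k * S (k + 1) * S k) := by noncomm_ring
      _ = _ := by rw [hb]; noncomm_ring

lemma symmetrizer_right_dvd (hc : ∀ i j, i + 2 ≤ j → Commute (S i) (S j))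
    (hb : ∀ i, S i * S (i + 1) * S i = S (i + 1) * S i * S (i + 1)) {n i : ℕ}
    (h : i + 2 ≤ n) : ∃ Y, symmetrizer S n = Y * (1 + S i) := by
  induction n, h using Nat.le_induction with
  | base =>
    obtain ⟨Y, hY⟩ := cosetSum_mul_cosetSum hc hb i
    refine ⟨Y * symmetrizer S i, ?_⟩
    have h1 : Commute (symmetrizer S i) (1 + S i) :=
      (Commute.one_right _).add_right (commute_symmetrizer hc le_rfl)
    rw [mul_assoc, h1.eq, ← mul_assoc, ← hY, mul_assoc]
    rfl
  | succ n _ ih =>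
    obtain ⟨Y, hY⟩ := ih
    exact ⟨cosetSum S n * Y, by rw [mul_assoc, ← hY]; rfl⟩

end SymmetrizerRing

section Hecke

open Equiv

variable {k M ι : Type*} [Field k] [AddCommGroup M] [Module k M] [DecidableEq ι]

/-- Postcomposition with an endomorphism of `M`, as an algebra homomorphism. -/
def postcomp (k M J : Type*) [Field k] [AddCommGroup M] [Module k M] :
    Module.End k M →ₐ[k] Module.End k (J → M) where
  toFun P := P.compLeft J
  map_one' := rfl
  map_mul' _ _ := rfl
  map_zero' := rfl
  map_add' _ _ := rfl
  commutes' _ := rfl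

@[simp] lemma postcomp_apply {J : Type*} (P : Module.End k M) (f : J → M) (x : J) :
    postcomp k M J P f x = P (f x) := rfl

/-- The generator of the finite Hecke algebra attached to the sites `i` and `j`, acting on
functions of a tuple of colours. -/
def hecke (M : Type*) [AddCommGroup M] [Module k M] (p : k) (i j : ι) :
    Module.End k ((ι → ℤ) → M) where
  toFun f a := if a i = a j then p • f a else
    f (a ∘ swap i j) + (if a i < a j then (p - p⁻¹) • f a else 0)
  map_add' f g := by
    ext a
    simp only [Pi.add_apply]
    split_ifs <;> module
  map_smul' c f := by
    ext a
    simp only [Pi.smul_apply, RingHom.id_apply]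
    split_ifs <;> module

lemma hecke_apply (p : k) (i j : ι) (f : (ι → ℤ) → M) (a : ι → ℤ) :
    hecke M p i j f a = if a i = a j then p • f a else
      f (a ∘ swap i j) + (if a i < a j then (p - p⁻¹) • f a else 0) := rfl

lemma hecke_commute_postcomp (p : k) (i j : ι) (P : Module.End k M) :
    Commute (hecke M p i j) (postcomp k M (ι → ℤ) P) := by
  refine LinearMap.ext fun f => funext fun a => ?_
  simp only [Module.End.mul_apply, postcomp_apply, hecke_apply]
  split_ifs <;> simp

lemma comp_swap_comp_swap (a : ι → ℤ) (i j : ι) : (a ∘ swap i j) ∘ swap i j = a := by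
  ext x; simp

lemma hecke_mul_self {p : k} (hp : p ≠ 0) {i j : ι} :
    hecke M p i j * hecke M p i j = (p - p⁻¹) • hecke M p i j + 1 := by
  refine LinearMap.ext fun f => funext fun a => ?_
  simp only [Module.End.mul_apply, hecke_apply, LinearMap.add_apply, LinearMap.smul_apply,
    Pi.add_apply, Pi.smul_apply, Module.End.one_apply, Function.comp_apply, swap_apply_left,
    swap_apply_right, comp_swap_comp_swap]
  have hp' : p * p = (p - p⁻¹) * p + 1 := by field_simp; ring
  rcases lt_trichotomy (a i) (a j) with h | h | h
  · simp only [h.ne, h, h.ne', h.not_gt, if_true, if_false]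
    module
  · simp only [h, if_true, smul_smul]
    rw [hp']
    module
  · simp only [h.ne, h, h.ne', h.not_gt, if_true, if_false]
    module

/-- The tuple `a` with entries at `i, j, l` replaced by `x, y, w`. -/
def setThree (a : ι → ℤ) (i j l : ι) (x y w : ℤ) : ι → ℤ :=
  fun n => if n = i then x else if n = j then y else if n = l then w else a n

lemma hecke_braid {p : k} (hp : p ≠ 0) {i j l : ι} (hij : i ≠ j) (hjl : j ≠ l) (hil : i ≠ l) :
    hecke M p i j * hecke M p j l * hecke M p i j =
      hecke M p j l * hecke M p i j * hecke M p j l := by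
  refine LinearMap.ext fun f => funext fun a => ?_
  have ha : a = setThree a i j l (a i) (a j) (a l) := by
    ext n; unfold setThree; split_ifs <;> simp_all
  have h1 : ∀ x y w, setThree a i j l x y w ∘ swap i j = setThree a i j l y x w := by
    intro x y w
    ext n
    rcases eq_or_ne n i with rfl | hi
    · simp [setThree, hij.symm]
    rcases eq_or_ne n j with rfl | hj
    · simp [setThree, hi]
    simp [setThree, swap_apply_of_ne_of_ne hi hj, hi, hj]
  have h2 : ∀ x y w, setThree a i j l x y w ∘ swap j l = setThree a i j l x w y := by
    intro x y w
    ext n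
    rcases eq_or_ne n j with rfl | hj
    · simp [setThree, hil.symm, hij.symm, hjl.symm]
    rcases eq_or_ne n l with rfl | hl
    · simp [setThree, hij.symm, hjl.symm, hil.symm]
    simp [setThree, swap_apply_of_ne_of_ne hj hl, hl, hj]
  have e1 : ∀ x y w, setThree a i j l x y w i = x := by simp [setThree]
  have e2 : ∀ x y w, setThree a i j l x y w j = y := by simp [setThree, hij.symm]
  have e3 : ∀ x y w, setThree a i j l x y w l = w := by simp [setThree, hil.symm, hjl.symm]
  rw [ha]
  generalize a i = x, a j = y, a l = w
  simp only [Module.End.mul_apply, hecke_apply, h1, h2, e1, e2, e3]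
  rcases lt_trichotomy x y with h | h | h <;> rcases lt_trichotomy y w with h' | h' | h' <;>
  rcases lt_trichotomy x w with h'' | h'' | h'' <;> first
    | omega
    | (subst_vars
       simp (disch := omega) only [↓reduceIte, if_pos, if_neg]
       first
       | done
       | match_scalars <;> first | ring1 | (field_simp; ring1))

lemma hecke_commute {p : k} {i j l m : ι} (hil : i ≠ l) (him : i ≠ m) (hjl : j ≠ l)
    (hjm : j ≠ m) : Commute (hecke M p i j) (hecke M p l m) := by
  refine LinearMap.ext fun f => funext fun a => ?_
  have hs : (a ∘ swap l m) ∘ swap i j = (a ∘ swap i j) ∘ swap l m := by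
    have : Commute (swap i j) (swap l m) :=
      (Perm.Disjoint.commute (by
        intro x
        by_cases hx : x = i ∨ x = j
        · right; rcases hx with rfl | rfl <;> exact swap_apply_of_ne_of_ne ‹_› ‹_›
        · left; push Not at hx; exact swap_apply_of_ne_of_ne hx.1 hx.2))
    ext x
    have := congrArg (fun g : Perm ι => a (g x)) this.eq
    simpa using this.symm
  simp only [Module.End.mul_apply, hecke_apply, Function.comp_apply, hs,
    swap_apply_of_ne_of_ne hil him, swap_apply_of_ne_of_ne hjl hjm,
    swap_apply_of_ne_of_ne hil.symm hjl.symm, swap_apply_of_ne_of_ne him.symm hjm.symm]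
  split_ifs <;> module

end Hecke

section AffineHecke

open Equiv

lemma braid_of_relations {k R : Type*} [CommRing k] [Ring R] [Algebra k R] {c : k}
    {s s' D D' T T' : R} (r0 : s * s' * s = s' * s * s') (r1 : s * s' * D = D' * s * s')
    (r2 : D * s' * s = s' * s * D') (r3 : s * D' * s = s' * D * s')
    (r4 : s * D' * D + D * D' * s + s * D' * s = D' * s * D')
    (r5 : D * s' * D = s' * D * D' + D' * D * s' + s' * D * s') (r6 : D * D' * D = D' * D * D')
    (t0 : T * T' * T = T' * T * T') (t1 : T * T = c • T + 1) (t2 : T' * T' = c • T' + 1)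
    (c1 : s * T = T * s) (c2 : s' * T = T * s') (c3 : D * T = T * D) (c4 : D' * T = T * D')
    (c5 : s * T' = T' * s) (c6 : s' * T' = T' * s') (c7 : D * T' = T' * D)
    (c8 : D' * T' = T' * D') :
    (T * s + c • D) * (T' * s' + c • D') * (T * s + c • D) =
      (T' * s' + c • D') * (T * s + c • D) * (T' * s' + c • D') := by
  have a1 (x : R) : s * (T * x) = T * (s * x) := by rw [← mul_assoc, c1, mul_assoc]
  have a2 (x : R) : s' * (T * x) = T * (s' * x) := by rw [← mul_assoc, c2, mul_assoc]
  have a3 (x : R) : D * (T * x) = T * (D * x) := by rw [← mul_assoc, c3, mul_assoc]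
  have a4 (x : R) : D' * (T * x) = T * (D' * x) := by rw [← mul_assoc, c4, mul_assoc]
  have a5 (x : R) : s * (T' * x) = T' * (s * x) := by rw [← mul_assoc, c5, mul_assoc]
  have a6 (x : R) : s' * (T' * x) = T' * (s' * x) := by rw [← mul_assoc, c6, mul_assoc]
  have a7 (x : R) : D * (T' * x) = T' * (D * x) := by rw [← mul_assoc, c7, mul_assoc]
  have a8 (x : R) : D' * (T' * x) = T' * (D' * x) := by rw [← mul_assoc, c8, mul_assoc]
  calc _ = (T * T' * T) * (s * s' * s) + c • (T * T' * (s * s' * D))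
        + c • (T * T * (s * D' * s)) + c • (T' * T * (D * s' * s))
        + c • c • (T * (s * D' * D + D * D' * s)) + c • c • (T' * (D * s' * D))
        + c • c • c • (D * D' * D) := by
        simp only [add_mul, mul_add, smul_mul_assoc, mul_smul_comm, mul_assoc, smul_add,
          a1, a2, a3, a4, a5, a7]
        abel
    _ = (T' * T * T') * (s' * s * s') + c • (T' * T * (s' * s * D'))
        + c • (T' * T' * (s' * D * s')) + c • (T * T' * (D' * s * s'))
        + c • c • (T' * (s' * D * D' + D' * D * s')) + c • c • (T * (D' * s * D'))
        + c • c • c • (D' * D * D') := by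
        rw [r0, r1, r2, r5, r6, ← r4, t0, t1, t2, r3]
        simp only [add_mul, mul_add, smul_mul_assoc, smul_add, one_mul]
        abel
    _ = _ := by
        simp only [add_mul, mul_add, smul_mul_assoc, mul_smul_comm, mul_assoc, smul_add,
          a2, a4, a5, a6, a7, a8]
        abel

variable {k F ι : Type*} [Field k] [Field F] [Algebra k F] [DecidableEq ι]
  (σ : Perm ι →* (F ≃ₐ[k] F)) (z : ι → F) (q : k)

/-- The exchange of the variables `z i` and `z j`. -/
def exch (i j : ι) : Module.End k F := (σ (swap i j)).toLinearMap

/-- The divided difference operator `f ↦ (f - s f) / (1 - z j / z i)`. -/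
def dd (i j : ι) : Module.End k F :=
  LinearMap.mulLeft k (z i / (z i - z j)) * (1 - exch σ i j)

lemma exch_apply (i j : ι) (f : F) : exch σ i j f = σ (swap i j) f := rfl

lemma dd_apply (i j : ι) (f : F) :
    dd σ z i j f = z i / (z i - z j) * (f - σ (swap i j) f) := rfl

variable {σ z}

lemma exch_exch (i j : ι) (f : F) : σ (swap i j) (σ (swap i j) f) = f := by
  rw [← AlgEquiv.mul_apply, ← map_mul, swap_mul_self, map_one, AlgEquiv.one_apply]

lemma exch_braid_apply {i j l : ι} (hij : i ≠ j) (hjl : j ≠ l) (hil : i ≠ l) (f : F) :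
    σ (swap i j) (σ (swap j l) (σ (swap i j) f)) =
      σ (swap j l) (σ (swap i j) (σ (swap j l) f)) := by
  simp only [← AlgEquiv.mul_apply, ← map_mul]
  congr 2
  ext x
  simp only [Perm.mul_apply, swap_apply_def]
  split_ifs <;> simp_all

lemma disjoint_swap_swap {i j l m : ι} (hil : i ≠ l) (him : i ≠ m) (hjl : j ≠ l)
    (hjm : j ≠ m) : Commute (swap i j) (swap l m) := by
  refine Perm.Disjoint.commute fun x => ?_
  by_cases hx : x = i ∨ x = j
  · right; rcases hx with rfl | rfl <;> exact swap_apply_of_ne_of_ne ‹_› ‹_›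
  · left; push Not at hx; exact swap_apply_of_ne_of_ne hx.1 hx.2

lemma exch_commute_apply {i j l m : ι} (hil : i ≠ l) (him : i ≠ m) (hjl : j ≠ l)
    (hjm : j ≠ m) (f : F) :
    σ (swap i j) (σ (swap l m) f) = σ (swap l m) (σ (swap i j) f) := by
  simp only [← AlgEquiv.mul_apply, ← map_mul, (disjoint_swap_swap hil him hjl hjm).eq]

variable (σ z)

/-- The action of the generator of the affine Hecke algebra at the sites `i, j`, on functions of
the first colour tuple with values in `F`. -/
def affHecke (i j : ι) : Module.End k ((ι → ℤ) → F) :=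
  hecke F q i j * postcomp k F _ (exch σ i j) + (q - q⁻¹) • postcomp k F _ (dd σ z i j)

variable {σ z q} (hσ : ∀ g i, σ g (z i) = z (g i)) (hz : Function.Injective z)
include hσ hz

lemma exch_dd_relations {i j l : ι} (hij : i ≠ j) (hjl : j ≠ l) (hil : i ≠ l)
    {s s' D D' : Module.End k F} (hs : s = exch σ i j) (hs' : s' = exch σ j l)
    (hD : D = dd σ z i j) (hD' : D' = dd σ z j l) :
    s * s' * s = s' * s * s' ∧ s * s' * D = D' * s * s' ∧ D * s' * s = s' * s * D' ∧
      s * D' * s = s' * D * s' ∧ s * D' * D + D * D' * s + s * D' * s = D' * s * D' ∧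
      D * s' * D = s' * D * D' + D' * D * s' + s' * D * s' ∧ D * D' * D = D' * D * D' := by
  have hb := exch_braid_apply (σ := σ) hij hjl hil
  have n1 : z i - z j ≠ 0 := sub_ne_zero.2 (hz.ne hij)
  have n2 : z j - z l ≠ 0 := sub_ne_zero.2 (hz.ne hjl)
  have n3 : z i - z l ≠ 0 := sub_ne_zero.2 (hz.ne hil)
  have n1' : z j - z i ≠ 0 := sub_ne_zero.2 (hz.ne hij.symm)
  have n2' : z l - z j ≠ 0 := sub_ne_zero.2 (hz.ne hjl.symm)
  have n3' : z l - z i ≠ 0 := sub_ne_zero.2 (hz.ne hil.symm)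
  have e1 : swap i j l = l := swap_apply_of_ne_of_ne hil.symm hjl.symm
  have e2 : swap j l i = i := swap_apply_of_ne_of_ne hij hil
  subst hs hs' hD hD'
  refine ⟨?_, ?_, ?_, ?_, ?_, ?_, ?_⟩ <;> ext f
  · exact hb f
  · simp only [Module.End.mul_apply, exch_apply, dd_apply, map_mul, map_div₀, map_sub, hσ, hb,
      swap_apply_left, e1, e2]
  · simp only [Module.End.mul_apply, exch_apply, dd_apply, map_mul, map_div₀, map_sub, hσ, hb,
      swap_apply_right, e1, e2]
  · simp only [Module.End.mul_apply, exch_apply, dd_apply, map_mul, map_div₀, map_sub, hσ, hb,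
      swap_apply_left, swap_apply_right, e1, e2, exch_exch]
  · simp only [Module.End.mul_apply, LinearMap.add_apply, exch_apply, dd_apply, map_mul, map_div₀,
      map_sub, hσ, hb, swap_apply_left, swap_apply_right, e1, e2, exch_exch]
    field_simp
    ring
  · simp only [Module.End.mul_apply, LinearMap.add_apply, exch_apply, dd_apply, map_mul, map_div₀,
      map_sub, hσ, hb, swap_apply_left, swap_apply_right, e1, e2, exch_exch]
    field_simp
    ring
  · simp only [Module.End.mul_apply, dd_apply, map_mul, map_div₀,
      map_sub, hσ, hb, swap_apply_left, swap_apply_right, e1, e2, exch_exch]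
    field_simp
    ring

lemma affHecke_braid (hq : q ≠ 0) {i j l : ι} (hij : i ≠ j) (hjl : j ≠ l) (hil : i ≠ l) :
    affHecke σ z q i j * affHecke σ z q j l * affHecke σ z q i j =
      affHecke σ z q j l * affHecke σ z q i j * affHecke σ z q j l := by
  obtain ⟨r0, r1, r2, r3, r4, r5, r6⟩ := exch_dd_relations hσ hz hij hjl hil rfl rfl rfl rfl
  have key {P Q : Module.End k F} (h : P = Q) :
      postcomp k F (ι → ℤ) P = postcomp k F (ι → ℤ) Q := congrArg _ h
  replace r0 := key r0
  replace r1 := key r1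
  replace r2 := key r2
  replace r3 := key r3
  replace r4 := key r4
  replace r5 := key r5
  replace r6 := key r6
  simp only [map_mul, map_add] at r0 r1 r2 r3 r4 r5 r6
  have c (i j : ι) (P : Module.End k F) := (hecke_commute_postcomp q i j P).symm.eq
  unfold affHecke
  have t0 := hecke_braid (M := F) hq hij hjl hil
  have t1 := hecke_mul_self (M := F) hq (i := i) (j := j)
  have t2 := hecke_mul_self (M := F) hq (i := j) (j := l)
  have c1 := c i j (exch σ i j)
  have c2 := c i j (exch σ j l)
  have c3 := c i j (dd σ z i j)
  have c4 := c i j (dd σ z j l)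
  have c5 := c j l (exch σ i j)
  have c6 := c j l (exch σ j l)
  have c7 := c j l (dd σ z i j)
  have c8 := c j l (dd σ z j l)
  clear c key
  generalize postcomp k F (ι → ℤ) (exch σ i j) = s at *
  generalize postcomp k F (ι → ℤ) (exch σ j l) = s' at *
  generalize postcomp k F (ι → ℤ) (dd σ z i j) = D at *
  generalize postcomp k F (ι → ℤ) (dd σ z j l) = D' at *
  generalize hecke F q i j = T at *
  generalize hecke F q j l = T' at *
  generalize q - q⁻¹ = c at *
  have := @braid_of_relations k (Module.End k ((ι → ℤ) → F)) _ _ _ c s s' D D' T T'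
    r0 r1 r2 r3 r4 r5 r6 t0 t1 t2 c1 c2 c3 c4 c5 c6 c7 c8
  exact this

omit hz in
lemma affHecke_commute {i j l m : ι} (hil : i ≠ l) (him : i ≠ m) (hjl : j ≠ l) (hjm : j ≠ m) :
    Commute (affHecke σ z q i j) (affHecke σ z q l m) := by
  have e1 : swap i j l = l := swap_apply_of_ne_of_ne hil.symm hjl.symm
  have e2 : swap i j m = m := swap_apply_of_ne_of_ne him.symm hjm.symm
  have e3 : swap l m i = i := swap_apply_of_ne_of_ne hil him
  have e4 : swap l m j = j := swap_apply_of_ne_of_ne hjl hjm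
  have hc := exch_commute_apply (σ := σ) hil him hjl hjm
  have h1 : Commute (exch σ i j) (exch σ l m) := LinearMap.ext hc
  have h2 : Commute (exch σ i j) (dd σ z l m) := LinearMap.ext fun f => by
    simp only [Module.End.mul_apply, exch_apply, dd_apply, map_mul, map_div₀, map_sub, hσ, hc,
      e1, e2]
  have h3 : Commute (dd σ z i j) (exch σ l m) := LinearMap.ext fun f => by
    simp only [Module.End.mul_apply, exch_apply, dd_apply, map_mul, map_div₀, map_sub, hσ, hc,
      e3, e4]
  have h4 : Commute (dd σ z i j) (dd σ z l m) := LinearMap.ext fun f => by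
    simp only [Module.End.mul_apply, dd_apply, map_mul, map_div₀, map_sub, hσ, hc,
      e1, e2, e3, e4]
    ring
  have key {P Q : Module.End k F} (h : Commute P Q) :
      Commute (postcomp k F (ι → ℤ) P) (postcomp k F (ι → ℤ) Q) := h.map (postcomp k F (ι → ℤ))
  refine Commute.add_left (Commute.add_right ?_ ?_) (Commute.add_right ?_ ?_)
  · exact ((hecke_commute hil him hjl hjm).mul_right (hecke_commute_postcomp _ _ _ _)).mul_left
      ((hecke_commute_postcomp _ _ _ _).symm.mul_right (key h1))
  · exact ((hecke_commute_postcomp _ _ _ _).mul_left (key h2)).smul_right _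
  · exact ((hecke_commute_postcomp _ _ _ _).symm.mul_right (key h3)).smul_left _
  · exact ((key h4).smul_left _).smul_right _

end AffineHecke

section WedgeOperator

open Equiv

variable {k F ι : Type*} [Field k] [Field F] [Algebra k F] [DecidableEq ι]
  (σ : Perm ι →* (F ≃ₐ[k] F)) (z : ι → F) (q : k)

/-- The signed product of the actions of the affine Hecke algebra on the first colours and of the
finite Hecke algebra, at parameter `q⁻¹`, on the second colours. -/
def wedgeOp (i j : ι) : Module.End k ((ι → ℤ) → (ι → ℤ) → F) :=
  -(postcomp k _ (ι → ℤ) (affHecke σ z q i j) * hecke _ q⁻¹ i j)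

variable {σ z q}

lemma neg_mul_braid {R : Type*} [Ring R] {A A' T T' : R} (h0 : A * A' * A = A' * A * A')
    (h1 : T * T' * T = T' * T * T') (c1 : T * A = A * T) (c2 : T' * A = A * T')
    (c3 : T * A' = A' * T) (c4 : T' * A' = A' * T') :
    -(A * T) * -(A' * T') * -(A * T) = -(A' * T') * -(A * T) * -(A' * T') := by
  calc _ = -(A * (T * A') * (T' * A) * T) := by noncomm_ring
    _ = -(A * A' * (T * A) * T' * T) := by rw [c2, c3]; noncomm_ring
    _ = -((A * A' * A) * (T * T' * T)) := by rw [c1]; noncomm_ring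
    _ = -((A' * A * A') * (T' * T * T')) := by rw [h0, h1]
    _ = -(A' * A * (T' * A') * T * T') := by rw [c4]; noncomm_ring
    _ = -(A' * (T' * A) * (T * A') * T') := by rw [c2, c3]; noncomm_ring
    _ = _ := by noncomm_ring

lemma wedgeOp_braid (hσ : ∀ g i, σ g (z i) = z (g i)) (hz : Function.Injective z) (hq : q ≠ 0)
    {i j l : ι} (hij : i ≠ j) (hjl : j ≠ l) (hil : i ≠ l) :
    wedgeOp σ z q i j * wedgeOp σ z q j l * wedgeOp σ z q i j =
      wedgeOp σ z q j l * wedgeOp σ z q i j * wedgeOp σ z q j l := by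
  have h0 := congrArg (postcomp k _ (ι → ℤ)) (affHecke_braid hσ hz hq hij hjl hil)
  simp only [map_mul] at h0
  have c (i j l m : ι) := (hecke_commute_postcomp q⁻¹ l m (affHecke σ z q i j)).eq
  exact neg_mul_braid h0 (hecke_braid (inv_ne_zero hq) hij hjl hil) (c _ _ _ _) (c _ _ _ _)
    (c _ _ _ _) (c _ _ _ _)

lemma wedgeOp_commute (hσ : ∀ g i, σ g (z i) = z (g i)) {i j l m : ι}
    (hil : i ≠ l) (him : i ≠ m) (hjl : j ≠ l) (hjm : j ≠ m) :
    Commute (wedgeOp σ z q i j) (wedgeOp σ z q l m) := by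
  refine Commute.neg_left (Commute.neg_right
    (?_ : Commute (postcomp k _ (ι → ℤ) (affHecke σ z q i j) * hecke _ q⁻¹ i j)
      (postcomp k _ (ι → ℤ) (affHecke σ z q l m) * hecke _ q⁻¹ l m)))
  exact (((affHecke_commute hσ hil him hjl hjm).map (postcomp k _ (ι → ℤ))).mul_right
    (hecke_commute_postcomp _ _ _ _).symm).mul_left
    ((hecke_commute_postcomp _ _ _ _).mul_right (hecke_commute hil him hjl hjm))

lemma one_add_wedgeOp_apply (hq : q ≠ 0) {i j : ι} {v : (ι → ℤ) → (ι → ℤ) → F}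
    (hv : postcomp k _ (ι → ℤ) (affHecke σ z q i j) v = hecke _ q⁻¹ i j v + (q - q⁻¹) • v) :
    (1 + wedgeOp σ z q i j) v = 0 := by
  have h := congrArg (· v) (hecke_mul_self (M := (ι → ℤ) → F) (ι := ι) (inv_ne_zero hq)
    (i := i) (j := j))
  simp only [Module.End.mul_apply, LinearMap.add_apply, LinearMap.smul_apply, inv_inv,
    Module.End.one_apply] at h
  rw [wedgeOp, ← (hecke_commute_postcomp q⁻¹ i j (affHecke σ z q i j)).eq]
  simp only [LinearMap.add_apply, Module.End.one_apply, LinearMap.neg_apply,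
    Module.End.mul_apply, hv, map_add, map_smul, h]
  module

end WedgeOperator

section Spanning

variable {e r t u : ℤ}

/-- The pairs occurring on the right-hand side of the straightening relation for `t < u`. -/
def orderedBetween (t u : ℤ) : Set (ℤ × ℤ) :=
  {p | t ≤ p.2 ∧ p.2 < p.1 ∧ p.1 + p.2 = t + u}

lemma pairTerm_mem_supported {x y : ℤ} (h1 : t ≤ y) (h2 : y < x) (h3 : x + y = t + u) :
    pairTerm x y ∈ Finsupp.supported K K (orderedBetween t u) :=
  Finsupp.single_mem_supported K _ ⟨h1, h2, h3⟩

lemma pairSum_mem_supported {N γ : ℤ} (hN : 0 ≤ N) (hγ : 0 ≤ γ) (m0 : ℕ) (c : ℕ → K) :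
    pairSum N t u γ m0 c ∈ Finsupp.supported K K (orderedBetween t u) := by
  refine Submodule.sum_mem _ fun m _ => ?_
  have := mul_nonneg hN (Nat.cast_nonneg (α := ℤ) m)
  split_ifs with h
  · exact Submodule.smul_mem _ _ (pairTerm_mem_supported (by linarith) h (by ring))
  · exact Submodule.zero_mem _

lemma pairRHS_mem_supported (hN : 0 < e * r) (h : t < u) :
    pairRHS e r t u ∈ Finsupp.supported K K (orderedBetween t u) := by
  have hu : pairTerm u t ∈ Finsupp.supported K K (orderedBetween t u) :=
    pairTerm_mem_supported le_rfl h (by ring)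
  have hα := Int.emod_nonneg (aFun e u - aFun e t) hN.ne'
  have hβ := Int.emod_nonneg (e * (bFun e r u - bFun e r t)) hN.ne'
  have hs {γ : ℤ} (hγ : 0 ≤ γ) (m0 : ℕ) (c : ℕ → K) :=
    pairSum_mem_supported (t := t) (u := u) hN.le hγ m0 c
  have hu' := Submodule.neg_mem _ hu
  unfold pairRHS
  dsimp only
  split_ifs
  · exact hu'
  · exact add_mem (neg_mem (Submodule.smul_mem _ _ hu)) (Submodule.smul_mem _ _
      (sub_mem (hs hα _ _) (hs le_rfl _ _)))
  · exact add_mem (neg_mem (Submodule.smul_mem _ _ hu)) (Submodule.smul_mem _ _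
      (sub_mem (hs hβ _ _) (hs le_rfl _ _)))
  · exact add_mem (add_mem (add_mem (add_mem (neg_mem hu) (Submodule.smul_mem _ _ (hs hβ _ _)))
      (Submodule.smul_mem _ _ (hs hα _ _))) (Submodule.smul_mem _ _ (hs (add_nonneg hα hβ) _ _)))
      (Submodule.smul_mem _ _ (hs le_rfl _ _))

lemma wedge_eq_sum {l : ℕ} (ts : Fin l → ℤ) {j j' : Fin l} (hj : (j' : ℕ) = j + 1)
    (h : ts j ≤ ts j') :
    wedge e r l ts = (pairRHS e r (ts j) (ts j')).sum fun p c =>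
      c • wedge e r l (updPair l ts j p) := by
  have h1 : Finsupp.single ts 1 - (pairRHS e r (ts j) (ts j')).sum
      (fun p c => Finsupp.single (updPair l ts (j : ℕ) p) c) ∈ Submodule.span K (relSet e r l) :=
    Submodule.subset_span ⟨ts, j, j', hj, h, rfl⟩
  refine ((Submodule.Quotient.eq _).2 h1).trans ?_
  rw [Finsupp.sum, ← Submodule.mkQ_apply, map_sum]
  refine Finset.sum_congr rfl fun p _ => ?_
  rw [← Finsupp.smul_single_one, map_smul]
  rfl

lemma wedge_eq_zero {l : ℕ} (ts : Fin l → ℤ) {j j' : Fin l} (hj : (j' : ℕ) = j + 1)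
    (h : ts j = ts j') : wedge e r l ts = 0 := by
  have h1 := wedge_eq_sum (e := e) (r := r) ts hj h.le
  have h2 : updPair l ts j (ts j, ts j) = ts := by
    ext i
    unfold updPair
    split_ifs with h3 h4
    · rw [Fin.ext h3]
    · rw [h, Fin.ext (h4.trans hj.symm)]
    · rfl
  have h3 : pairRHS e r (ts j) (ts j') = Finsupp.single (ts j, ts j) (-1) := by
    unfold pairRHS
    simp [pairTerm, h]
  rw [h3, Finsupp.sum_single_index (by exact zero_smul K _), h2, neg_one_smul] at h1
  have h4 : (2 : K) • wedge e r l ts = 0 := by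
    rw [two_smul]
    exact eq_neg_iff_add_eq_zero.1 h1
  exact (smul_eq_zero.1 h4).resolve_left two_ne_zero

lemma sum_updPair {l : ℕ} (ts : Fin l → ℤ) {j j' : Fin l} (hj : (j' : ℕ) = j + 1) (B : ℤ)
    (p : ℤ × ℤ) (hp : p.1 + p.2 = ts j + ts j') :
    ∑ i : Fin l, (i : ℤ) * (updPair l ts j p i + B) =
      ∑ i : Fin l, (i : ℤ) * (ts i + B) + (p.2 - ts j') := by
  have hne : j ≠ j' := fun h => by rw [h] at hj; omega
  have h1 : ∀ i : Fin l, (i : ℤ) * (updPair l ts j p i + B) - (i : ℤ) * (ts i + B) =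
      (if i = j then (j : ℤ) * (p.1 - ts j) else 0) +
        (if i = j' then (j' : ℤ) * (p.2 - ts j') else 0) := by
    intro i
    have hi : (i : ℕ) = j + 1 ↔ i = j' := by rw [← hj, Fin.ext_iff]
    have hi' : (i : ℕ) = j ↔ i = j := Fin.ext_iff.symm
    simp only [updPair, hi, hi']
    split_ifs with h h' h'
    · exact absurd (h.symm.trans h') hne
    · subst h; ring
    · subst h'; ring
    · ring
  rw [← sub_eq_iff_eq_add', ← Finset.sum_sub_distrib, Finset.sum_congr rfl fun i _ => h1 i,
    Finset.sum_add_distrib, Finset.sum_ite_eq' Finset.univ j, Finset.sum_ite_eq' Finset.univ j']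
  simp only [Finset.mem_univ, if_true, hj]
  push_cast
  linear_combination (j : ℤ) * hp

lemma wedge_mem_span (hN : 0 < e * r) {l : ℕ} (B : ℤ) (n : ℕ) (ts : Fin l → ℤ)
    (hB : ∀ i, -B ≤ ts i) (hn : ∑ i : Fin l, (i : ℤ) * (ts i + B) ≤ n) :
    wedge e r l ts ∈ Submodule.span K
      (Set.range fun ts : {f : Fin l → ℤ // StrictAnti f} => wedge e r l ts.1) := by
  induction n using Nat.strong_induction_on generalizing ts with
  | _ n ih =>
  by_cases hts : StrictAnti ts
  · exact Submodule.subset_span ⟨⟨ts, hts⟩, rfl⟩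
  obtain ⟨j, j', hj, hle⟩ : ∃ j j' : Fin l, (j' : ℕ) = j + 1 ∧ ts j ≤ ts j' := by
    cases l with
    | zero => exact absurd (fun i => i.elim0) hts
    | succ l =>
      rw [Fin.strictAnti_iff_succ_lt] at hts
      push Not at hts
      obtain ⟨i, hi⟩ := hts
      exact ⟨i.castSucc, i.succ, by simp, hi⟩
  rcases hle.eq_or_lt with heq | hlt
  · rw [wedge_eq_zero ts hj heq]
    exact zero_mem _
  rw [wedge_eq_sum ts hj hle]
  refine Submodule.sum_mem _ fun p hp => Submodule.smul_mem _ _ ?_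
  obtain ⟨h1, h2, h3⟩ := (Finsupp.mem_supported K _).1 (pairRHS_mem_supported hN hlt) hp
  have hB' : ∀ i, -B ≤ updPair l ts j p i := by
    intro i
    have := hB j
    unfold updPair
    split_ifs
    · omega
    · omega
    · exact hB i
  have h4 := sum_updPair ts hj B p h3
  have h5 : 0 ≤ ∑ i : Fin l, (i : ℤ) * (updPair l ts j p i + B) :=
    Finset.sum_nonneg fun i _ => mul_nonneg (Nat.cast_nonneg _) (by linarith [hB' i])
  exact ih (n - 1) (by omega) _ hB' (by omega)

lemma span_ordered_wedges (hN : 0 < e * r) (l : ℕ) :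
    Submodule.span K
      (Set.range fun ts : {f : Fin l → ℤ // StrictAnti f} => wedge e r l ts.1) = ⊤ := by
  rw [eq_top_iff]
  rintro x -
  induction x using Submodule.Quotient.induction_on with | _ x
  induction x using Finsupp.induction_linear with
  | zero => exact zero_mem _
  | add x y hx hy => exact add_mem hx hy
  | single ts c =>
    rw [← Finsupp.smul_single_one, Submodule.Quotient.mk_smul]
    obtain ⟨B, hB⟩ := (Set.finite_range fun i => -ts i).bddAbove
    refine Submodule.smul_mem _ _ (wedge_mem_span hN B
      (∑ i : Fin l, (i : ℤ) * (ts i + B)).toNat ts ?_ (Int.self_le_toNat _))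
    intro i
    have := hB ⟨i, rfl⟩
    linarith

end Spanning

section Colours

variable {e r a b m t u : ℤ}

/-- The integer with colours `a`, `b` and degree `m`. -/
def colourEnc (e r a b m : ℤ) : ℤ := a + e * (b - 1) - e * r * m

lemma aFun_colourEnc (ha : 1 ≤ a) (ha' : a ≤ e) : aFun e (colourEnc e r a b m) = a := by
  have h : colourEnc e r a b m - 1 = (a - 1) + e * (b - 1 - r * m) := by
    unfold colourEnc; ring
  rw [aFun, h, Int.add_mul_emod_self_left, Int.emod_eq_of_lt (by omega) (by omega)]
  ring

lemma bFun_colourEnc (ha : 1 ≤ a) (ha' : a ≤ e) (hb : 1 ≤ b) (hb' : b ≤ r) :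
    bFun e r (colourEnc e r a b m) = b := by
  have h : colourEnc e r a b m - 1 = ((a - 1) + e * (b - 1)) + e * r * (-m) := by
    unfold colourEnc; ring
  have h1 : 0 ≤ e * (b - 1) := mul_nonneg (by omega) (by omega)
  have h2 : e * (b - 1) ≤ e * (r - 1) := mul_le_mul_of_nonneg_left (by omega) (by omega)
  rw [bFun, h, Int.add_mul_emod_self_left, Int.emod_eq_of_lt (by omega) (by linarith),
    Int.add_mul_ediv_left _ _ (by omega), Int.ediv_eq_zero_of_lt (by omega) (by omega)]
  ring

lemma mFun_colourEnc (ha : 1 ≤ a) (ha' : a ≤ e) (hb : 1 ≤ b) (hb' : b ≤ r) :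
    mFun e r (colourEnc e r a b m) = m := by
  have hN : 0 < e * r := mul_pos (by omega) (by omega)
  rw [mFun, aFun_colourEnc ha ha', bFun_colourEnc ha ha' hb hb', colourEnc]
  exact Int.ediv_eq_of_eq_mul_left hN.ne' (by ring)

lemma aFun_mem (he : 0 < e) (t : ℤ) : 1 ≤ aFun e t ∧ aFun e t ≤ e := by
  have := Int.emod_nonneg (t - 1) he.ne'
  have := Int.emod_lt_of_pos (t - 1) he
  unfold aFun
  omega

lemma bFun_mem (he : 0 < e) (hr : 0 < r) (t : ℤ) : 1 ≤ bFun e r t ∧ bFun e r t ≤ r := by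
  have hN : 0 < e * r := mul_pos he hr
  have h1 := Int.ediv_nonneg (Int.emod_nonneg (t - 1) hN.ne') he.le
  have h2 : (t - 1) % (e * r) / e < r :=
    Int.ediv_lt_of_lt_mul he (by rw [mul_comm r]; exact Int.emod_lt_of_pos (t - 1) hN)
  unfold bFun
  omega

lemma colourEnc_surjective (he : 0 < e) (hr : 0 < r) (t : ℤ) :
    ∃ a b m, 1 ≤ a ∧ a ≤ e ∧ 1 ≤ b ∧ b ≤ r ∧ t = colourEnc e r a b m := by
  refine ⟨aFun e t, bFun e r t, -((t - 1) / (e * r)), (aFun_mem he t).1, (aFun_mem he t).2,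
    (bFun_mem he hr t).1, (bFun_mem he hr t).2, ?_⟩
  have h1 := Int.emod_add_mul_ediv (t - 1) (e * r)
  have h2 := Int.emod_add_mul_ediv ((t - 1) % (e * r)) e
  rw [Int.emod_emod_of_dvd _ (dvd_mul_right e r)] at h2
  unfold colourEnc aFun bFun
  linear_combination -h1 - h2

lemma colourEnc_aFun_bFun_mFun (he : 0 < e) (hr : 0 < r) (t : ℤ) :
    colourEnc e r (aFun e t) (bFun e r t) (mFun e r t) = t := by
  obtain ⟨a, b, m, h1, h2, h3, h4, rfl⟩ := colourEnc_surjective he hr t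
  rw [aFun_colourEnc h1 h2, bFun_colourEnc h1 h2 h3 h4, mFun_colourEnc h1 h2 h3 h4]

lemma sub_emod_of_mem {a a' : ℤ} {N : ℤ} (h1 : 1 ≤ a) (h2 : a ≤ N) (h3 : 1 ≤ a') (h4 : a' ≤ N) :
    (a' - a) % N = a' - a + if a' < a then N else 0 := by
  split_ifs with h
  · rw [← Int.add_emod_right, Int.emod_eq_of_lt (by omega) (by omega)]
  · rw [Int.emod_eq_of_lt (by omega) (by omega), add_zero]

lemma mul_sub_emod_of_mem {b b' : ℤ} (he : 0 < e) (h1 : 1 ≤ b) (h2 : b ≤ r) (h3 : 1 ≤ b')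
    (h4 : b' ≤ r) : (e * (b' - b)) % (e * r) = e * (b' - b) + if b' < b then e * r else 0 := by
  rw [Int.mul_emod_mul_of_pos _ _ he, sub_emod_of_mem h1 h2 h3 h4]
  split_ifs <;> ring

end Colours

section TwoSites

open Equiv

variable {k F ι : Type*} [Field k] [Field F] [Algebra k F] [DecidableEq ι] {i j : ι}

/-- The tuple `g` with entries at `i` and `j` replaced by `x` and `y`. -/
def setTwo (g : ι → ℤ) (i j : ι) (x y : ℤ) : ι → ℤ :=
  Function.update (Function.update g i x) j y

lemma setTwo_left (hij : i ≠ j) (g : ι → ℤ) (x y : ℤ) : setTwo g i j x y i = x := by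
  simp [setTwo, hij]

lemma setTwo_right (g : ι → ℤ) (x y : ℤ) : setTwo g i j x y j = y := by
  simp [setTwo]

lemma setTwo_comp_swap (hij : i ≠ j) (g : ι → ℤ) (x y : ℤ) :
    setTwo g i j x y ∘ swap i j = setTwo g i j y x := by
  ext n
  rcases eq_or_ne n i with rfl | hi
  · simp [setTwo, hij]
  rcases eq_or_ne n j with rfl | hj
  · simp [setTwo, hi.symm]
  simp [setTwo, swap_apply_of_ne_of_ne hi hj, hi, hj]

variable [Fintype ι] (σ : Perm ι →* (F ≃ₐ[k] F)) (z : ι → F) (q : k)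

lemma hecke_single {M : Type*} [AddCommGroup M] [Module k M] (p : k) (i j : ι) (a : ι → ℤ)
    (v : M) : hecke M p i j (Pi.single a v) = if a i = a j then Pi.single a (p • v) else
      Pi.single (a ∘ swap i j) v +
        if a i < a j then Pi.single a ((p - p⁻¹) • v) else 0 := by
  have hflip (x : ι → ℤ) : x ∘ swap i j = a ↔ x = a ∘ swap i j :=
    ⟨fun h => by rw [← h, comp_swap_comp_swap], fun h => by rw [h, comp_swap_comp_swap]⟩
  have hs : a i = a j → a ∘ swap i j = a := fun h => by
    ext n
    simp only [Function.comp_apply, swap_apply_def]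
    split_ifs with h1 h2
    · rw [h1, h]
    · rw [h2, h]
    · rfl
  ext x
  rw [hecke_apply]
  simp only [Pi.single_apply, hflip]
  by_cases hx : x = a
  · subst hx
    by_cases h : x i = x j
    · simp [h]
    · simp only [h, if_false, Pi.add_apply, Pi.single_apply]
      split_ifs <;> simp
  by_cases hx' : x = a ∘ swap i j
  · subst hx'
    simp only [Function.comp_apply, swap_apply_left, swap_apply_right]
    by_cases h : a i = a j
    · exact absurd (hs h) hx
    · simp only [Ne.symm h, h, hx, if_false, if_true, Pi.add_apply, Pi.single_apply]
      split_ifs <;> simp [hx]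
  · simp only [hx, hx', if_false]
    split_ifs <;> simp [hx, hx']

lemma postcomp_single {M J : Type*} [AddCommGroup M] [Module k M] [DecidableEq J]
    (P : Module.End k M) (a : J) (v : M) :
    postcomp k M J P (Pi.single a v) = Pi.single a (P v) := by
  ext x
  rw [postcomp_apply, Pi.single_apply, Pi.single_apply]
  split_ifs <;> simp

variable (k) in
/-- The function with value `f` at the colour tuples with entries `x, y` and `x', y'` at the
sites `i, j`. -/
def siteVec (a₀ b₀ : ι → ℤ) (i j : ι) (x y x' y' : ℤ) : F →ₗ[k] ((ι → ℤ) → (ι → ℤ) → F) :=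
  LinearMap.single k (fun _ => (ι → ℤ) → F) (setTwo b₀ i j x' y') ∘ₗ
    LinearMap.single k (fun _ => F) (setTwo a₀ i j x y)

/-- The difference of the two Hecke actions; its kernel consists of vectors killed by
`1 + wedgeOp`. -/
def heckeDiff (i j : ι) : Module.End k ((ι → ℤ) → (ι → ℤ) → F) :=
  postcomp k _ (ι → ℤ) (affHecke σ z q i j) - hecke _ q⁻¹ i j - (q - q⁻¹) • 1

variable {σ z q}

omit [Fintype ι] in
lemma one_add_wedgeOp_apply_of_heckeDiff (hq : q ≠ 0) {v : (ι → ℤ) → (ι → ℤ) → F}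
    (h : heckeDiff σ z q i j v = 0) :
    (1 + wedgeOp σ z q i j) v = 0 := by
  refine one_add_wedgeOp_apply hq ?_
  simp only [heckeDiff, LinearMap.sub_apply, LinearMap.smul_apply, Module.End.one_apply] at h
  rw [← sub_eq_zero, ← h]
  abel

lemma heckeDiff_siteVec (hij : i ≠ j) (a₀ b₀ : ι → ℤ) (x y x' y' : ℤ) (f : F) :
    heckeDiff σ z q i j (siteVec k a₀ b₀ i j x y x' y' f) =
      (if x = y then siteVec k a₀ b₀ i j x y x' y' (q • σ (swap i j) f) else
        siteVec k a₀ b₀ i j y x x' y' (σ (swap i j) f) +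
          if x < y then siteVec k a₀ b₀ i j x y x' y' ((q - q⁻¹) • σ (swap i j) f) else 0) +
      siteVec k a₀ b₀ i j x y x' y' ((q - q⁻¹) • dd σ z i j f) -
      (if x' = y' then siteVec k a₀ b₀ i j x y x' y' (q • f) else
        siteVec k a₀ b₀ i j x y y' x' f +
          if y' < x' then siteVec k a₀ b₀ i j x y x' y' ((q - q⁻¹) • f) else 0) := by
  simp only [heckeDiff, LinearMap.sub_apply, LinearMap.smul_apply, Module.End.one_apply, siteVec,
    LinearMap.comp_apply, LinearMap.single_apply, postcomp_single, hecke_single,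
    affHecke, LinearMap.add_apply, Module.End.mul_apply, setTwo_left hij, setTwo_right,
    setTwo_comp_swap hij, exch_apply, inv_inv, sub_sub]
  congr 1
  · split_ifs <;> simp only [Pi.single_add, Pi.single_smul, add_zero]
  · rcases lt_trichotomy x' y' with h | h | h
    · simp only [h.ne, h, h.not_gt, if_true, if_false, add_zero]
      simp only [Pi.single_smul]
      module
    · simp only [h, if_true, ← Pi.single_smul, ← Pi.single_add, ← add_smul]
      congr 3
      ring
    · simp only [h.ne', h, h.not_gt, if_true, if_false, add_zero, Pi.single_smul]

end TwoSites

section LocalRelations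

set_option linter.unusedSimpArgs false

open Equiv

variable {k F ι : Type*} [Field k] [Field F] [Algebra k F] [DecidableEq ι] [Fintype ι] {i j : ι}
  {σ : Perm ι →* (F ≃ₐ[k] F)} {z : ι → F} {q : k} {a₀ b₀ : ι → ℤ}

lemma heckeDiff_four_colours (hij : i ≠ j) {x y x' y' : ℤ} (h : x ≠ y) (h' : x' ≠ y')
    {f₁ f₂ f₃ f₄ : F}
    (e1 : σ (swap i j) f₃ + (if x < y then (q - q⁻¹) • σ (swap i j) f₁ else 0) +
      (q - q⁻¹) • dd σ z i j f₁ = f₄ + if y' < x' then (q - q⁻¹) • f₁ else 0)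
    (e2 : σ (swap i j) f₄ + (if y < x then (q - q⁻¹) • σ (swap i j) f₂ else 0) +
      (q - q⁻¹) • dd σ z i j f₂ = f₃ + if x' < y' then (q - q⁻¹) • f₂ else 0)
    (e3 : σ (swap i j) f₁ + (if y < x then (q - q⁻¹) • σ (swap i j) f₃ else 0) +
      (q - q⁻¹) • dd σ z i j f₃ = f₂ + if y' < x' then (q - q⁻¹) • f₃ else 0)
    (e4 : σ (swap i j) f₂ + (if x < y then (q - q⁻¹) • σ (swap i j) f₄ else 0) +
      (q - q⁻¹) • dd σ z i j f₄ = f₁ + if x' < y' then (q - q⁻¹) • f₄ else 0) :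
    heckeDiff σ z q i j (siteVec k a₀ b₀ i j x y x' y' f₁ + siteVec k a₀ b₀ i j y x y' x' f₂ +
      siteVec k a₀ b₀ i j y x x' y' f₃ + siteVec k a₀ b₀ i j x y y' x' f₄) = 0 := by
  have z0 (u v u' v' : ℤ) (p : Prop) [Decidable p] (f : F) :
      (if p then siteVec k a₀ b₀ i j u v u' v' f else 0) =
        siteVec k a₀ b₀ i j u v u' v' (if p then f else 0) := by
    split_ifs <;> simp
  simp only [map_add (heckeDiff σ z q i j), heckeDiff_siteVec hij, h, h', h.symm, h'.symm,
    if_false, z0]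
  have g1 := congrArg (siteVec k a₀ b₀ i j x y x' y') e1
  have g2 := congrArg (siteVec k a₀ b₀ i j y x y' x') e2
  have g3 := congrArg (siteVec k a₀ b₀ i j y x x' y') e3
  have g4 := congrArg (siteVec k a₀ b₀ i j x y y' x') e4
  simp only [map_add (siteVec k a₀ b₀ i j _ _ _ _)] at g1 g2 g3 g4
  linear_combination (norm := abel) g1 + g2 + g3 + g4

lemma heckeDiff_same_second (hij : i ≠ j) {x y x' : ℤ} (h : x ≠ y) {f₁ f₂ : F}
    (e1 : σ (swap i j) f₂ + (if x < y then (q - q⁻¹) • σ (swap i j) f₁ else 0) +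
      (q - q⁻¹) • dd σ z i j f₁ = q • f₁)
    (e2 : σ (swap i j) f₁ + (if y < x then (q - q⁻¹) • σ (swap i j) f₂ else 0) +
      (q - q⁻¹) • dd σ z i j f₂ = q • f₂) :
    heckeDiff σ z q i j (siteVec k a₀ b₀ i j x y x' x' f₁ +
      siteVec k a₀ b₀ i j y x x' x' f₂) = 0 := by
  have z0 (u v u' v' : ℤ) (p : Prop) [Decidable p] (f : F) :
      (if p then siteVec k a₀ b₀ i j u v u' v' f else 0) =
        siteVec k a₀ b₀ i j u v u' v' (if p then f else 0) := by
    split_ifs <;> simp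
  simp only [map_add (heckeDiff σ z q i j), heckeDiff_siteVec hij, h, h.symm,
    if_false, if_true, z0]
  have g1 := congrArg (siteVec k a₀ b₀ i j x y x' x') e1
  have g2 := congrArg (siteVec k a₀ b₀ i j y x x' x') e2
  simp only [map_add (siteVec k a₀ b₀ i j _ _ _ _)] at g1 g2
  linear_combination (norm := abel) g1 + g2

lemma heckeDiff_same_first (hij : i ≠ j) {x x' y' : ℤ} (h' : x' ≠ y') {f₁ f₂ : F}
    (e1 : q • σ (swap i j) f₁ + (q - q⁻¹) • dd σ z i j f₁ =
      f₂ + if y' < x' then (q - q⁻¹) • f₁ else 0)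
    (e2 : q • σ (swap i j) f₂ + (q - q⁻¹) • dd σ z i j f₂ =
      f₁ + if x' < y' then (q - q⁻¹) • f₂ else 0) :
    heckeDiff σ z q i j (siteVec k a₀ b₀ i j x x x' y' f₁ +
      siteVec k a₀ b₀ i j x x y' x' f₂) = 0 := by
  have z0 (u v u' v' : ℤ) (p : Prop) [Decidable p] (f : F) :
      (if p then siteVec k a₀ b₀ i j u v u' v' f else 0) =
        siteVec k a₀ b₀ i j u v u' v' (if p then f else 0) := by
    split_ifs <;> simp
  simp only [map_add (heckeDiff σ z q i j), heckeDiff_siteVec hij, h', h'.symm,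
    if_false, if_true, z0]
  have g1 := congrArg (siteVec k a₀ b₀ i j x x x' y') e1
  have g2 := congrArg (siteVec k a₀ b₀ i j x x y' x') e2
  simp only [map_add (siteVec k a₀ b₀ i j _ _ _ _)] at g1 g2
  linear_combination (norm := abel) g1 + g2

lemma heckeDiff_same (hij : i ≠ j) {x x' : ℤ} {f : F} (e : σ (swap i j) f = f) :
    heckeDiff σ z q i j (siteVec k a₀ b₀ i j x x x' x' f) = 0 := by
  simp only [heckeDiff_siteVec hij, if_true, dd_apply, e, sub_self, mul_zero, smul_zero, map_zero,
    add_zero]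

variable (k σ z q a₀ b₀) in
/-- The image under `heckeDiff` of the vector with given colours and degrees at the
sites `i, j`. -/
def degVec (R : F) (i j : ι) (x y x' y' m n : ℤ) : (ι → ℤ) → (ι → ℤ) → F :=
  heckeDiff σ z q i j (siteVec k a₀ b₀ i j x y x' y' (z i ^ m * z j ^ n * R))

section

variable (hσ : ∀ g i, σ g (z i) = z (g i)) (hz : Function.Injective z) (hz0 : ∀ i, z i ≠ 0)
  (hq : q ≠ 0) {R : F} (hij : i ≠ j) (hR : σ (swap i j) R = R)

omit [Fintype ι] in
include hσ hR in
lemma exch_deg (m n : ℤ) :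
    σ (swap i j) (z i ^ m * z j ^ n * R) = z j ^ m * z i ^ n * R := by
  simp only [map_mul, map_zpow₀, hσ, hR, swap_apply_left, swap_apply_right]

local notation "V" => degVec k σ z q a₀ b₀ R i j

include hσ hR hij in
lemma degVec_same (x x' m n : ℤ) : V x x x' x' m n + V x x x' x' n m = 0 := by
  rw [degVec, degVec, ← map_add, ← map_add]
  refine heckeDiff_same hij ?_
  rw [map_add, exch_deg hσ hR, exch_deg hσ hR]
  ring

include hσ hz hz0 hq hR hij

lemma degVec_second_rec {x y : ℤ} (x' m n δ : ℤ) (h : x < y ∧ δ = 0 ∨ y < x ∧ δ = 1) :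
    V x y x' x' m n + q⁻¹ • V y x x' x' n m =
      (q⁻¹ ^ 2 - 1) • V x y x' x' (n + δ) (m - δ) + q⁻¹ • V y x x' x' (n + 1) (m - 1) +
        q⁻¹ ^ 2 • V x y x' x' (m - 1) (n + 1) := by
  have hxy : x ≠ y := by omega
  have hd : z i - z j ≠ 0 := sub_ne_zero.2 (hz.ne hij)
  have hi := hz0 i
  have hj := hz0 j
  have hQ : algebraMap k F q ≠ 0 := by simpa using hq
  have key := heckeDiff_same_second (a₀ := a₀) (b₀ := b₀) (z := z) (q := q) (x' := x') hij hxy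
    (σ := σ)
    (f₁ := z i ^ m * z j ^ n * R - (q⁻¹ ^ 2 - 1) • (z i ^ (n + δ) * z j ^ (m - δ) * R)
      - q⁻¹ ^ 2 • (z i ^ (m - 1) * z j ^ (n + 1) * R))
    (f₂ := q⁻¹ • (z i ^ n * z j ^ m * R) - q⁻¹ • (z i ^ (n + 1) * z j ^ (m - 1) * R)) ?_ ?_
  · simp only [map_sub, map_add, map_smul] at key
    unfold degVec
    linear_combination (norm := module) key
  all_goals
    simp only [map_sub, map_smul, dd_apply, exch_deg hσ hR]
    simp only [Algebra.smul_def, map_sub, map_inv₀, map_pow, map_one, zpow_add₀ hi, zpow_add₀ hj,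
      zpow_sub₀ hi, zpow_sub₀ hj, zpow_one]
    generalize algebraMap k F q = Q at *
    generalize z i ^ m = A, z i ^ n = B, z j ^ m = C, z j ^ n = D
    generalize z i = Z, z j = Y at *
    rcases h with ⟨h, rfl⟩ | ⟨h, rfl⟩ <;>
    simp only [h, h.not_gt, if_true, if_false, zpow_zero, zpow_one] <;> field_simp <;> ring

lemma degVec_second_base₀ {x y : ℤ} (x' n δ : ℤ) (h : x < y ∧ δ = 0 ∨ y < x ∧ δ = 1) :
    V x y x' x' (n + δ) n + q⁻¹ • V y x x' x' n (n + δ) = 0 := by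
  have hxy : x ≠ y := by omega
  have hd : z i - z j ≠ 0 := sub_ne_zero.2 (hz.ne hij)
  have hi := hz0 i
  have hj := hz0 j
  have hQ : algebraMap k F q ≠ 0 := by simpa using hq
  have key := heckeDiff_same_second (a₀ := a₀) (b₀ := b₀) (z := z) (q := q) (x' := x') hij hxy
    (σ := σ)
    (f₁ := z i ^ (n + δ) * z j ^ n * R)
    (f₂ := q⁻¹ • (z i ^ n * z j ^ (n + δ) * R)) ?_ ?_
  · simp only [map_sub, map_add, map_neg, map_smul, map_zero] at key
    unfold degVec
    linear_combination (norm := module) key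
  all_goals
    simp only [map_sub, map_add, map_neg, map_smul, map_zero, dd_apply, exch_deg hσ hR]
    simp only [Algebra.smul_def, map_sub, map_inv₀, map_pow, map_one, zpow_add₀ hi, zpow_add₀ hj,
      zpow_sub₀ hi, zpow_sub₀ hj, zpow_one]
    generalize algebraMap k F q = Q at *
    generalize z i ^ n = B, z j ^ n = D
    generalize z i = Z, z j = Y at *
    rcases h with ⟨h, rfl⟩ | ⟨h, rfl⟩ <;>
    simp only [h, h.not_gt, if_true, if_false, zpow_zero, zpow_one] <;> field_simp <;> ring

lemma degVec_second_base₁ {x y : ℤ} (x' n δ : ℤ) (h : x < y ∧ δ = 0 ∨ y < x ∧ δ = 1) :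
    V x y x' x' (n + δ + 1) n + q⁻¹ • V y x x' x' n (n + δ + 1) =
      (q⁻¹ ^ 2 - 1) • V x y x' x' (n + δ) (n + 1) := by
  have hxy : x ≠ y := by omega
  have hd : z i - z j ≠ 0 := sub_ne_zero.2 (hz.ne hij)
  have hi := hz0 i
  have hj := hz0 j
  have hQ : algebraMap k F q ≠ 0 := by simpa using hq
  have key := heckeDiff_same_second (a₀ := a₀) (b₀ := b₀) (z := z) (q := q) (x' := x') hij hxy
    (σ := σ)
    (f₁ := z i ^ (n + δ + 1) * z j ^ n * R -
      (q⁻¹ ^ 2 - 1) • (z i ^ (n + δ) * z j ^ (n + 1) * R))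
    (f₂ := q⁻¹ • (z i ^ n * z j ^ (n + δ + 1) * R)) ?_ ?_
  · simp only [map_sub, map_add, map_neg, map_smul, map_zero] at key
    unfold degVec
    linear_combination (norm := module) key
  all_goals
    simp only [map_sub, map_add, map_neg, map_smul, map_zero, dd_apply, exch_deg hσ hR]
    simp only [Algebra.smul_def, map_sub, map_inv₀, map_pow, map_one, zpow_add₀ hi, zpow_add₀ hj,
      zpow_sub₀ hi, zpow_sub₀ hj, zpow_one]
    generalize algebraMap k F q = Q at *
    generalize z i ^ n = B, z j ^ n = D
    generalize z i = Z, z j = Y at *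
    rcases h with ⟨h, rfl⟩ | ⟨h, rfl⟩ <;>
    simp only [h, h.not_gt, if_true, if_false, zpow_zero, zpow_one] <;> field_simp <;> ring

lemma degVec_first_rec {x' y' : ℤ} (x m n δ : ℤ) (h : x' < y' ∧ δ = 0 ∨ y' < x' ∧ δ = 1) :
    V x x x' y' m n + q • V x x y' x' n m =
      (q ^ 2 - 1) • V x x x' y' (n + δ) (m - δ) + q • V x x y' x' (n + 1) (m - 1) +
        q ^ 2 • V x x x' y' (m - 1) (n + 1) := by
  have hxy : x' ≠ y' := by omega
  have hd : z i - z j ≠ 0 := sub_ne_zero.2 (hz.ne hij)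
  have hi := hz0 i
  have hj := hz0 j
  have hQ : algebraMap k F q ≠ 0 := by simpa using hq
  have key := heckeDiff_same_first (a₀ := a₀) (b₀ := b₀) (z := z) (q := q) (x := x) hij hxy
    (σ := σ)
    (f₁ := z i ^ m * z j ^ n * R - (q ^ 2 - 1) • (z i ^ (n + δ) * z j ^ (m - δ) * R)
      - q ^ 2 • (z i ^ (m - 1) * z j ^ (n + 1) * R))
    (f₂ := q • (z i ^ n * z j ^ m * R) - q • (z i ^ (n + 1) * z j ^ (m - 1) * R)) ?_ ?_
  · simp only [map_sub, map_add, map_neg, map_smul, map_zero] at key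
    unfold degVec
    linear_combination (norm := module) key
  all_goals
    simp only [map_sub, map_add, map_neg, map_smul, map_zero, dd_apply, exch_deg hσ hR]
    simp only [Algebra.smul_def, map_sub, map_inv₀, map_pow, map_one, zpow_add₀ hi, zpow_add₀ hj,
      zpow_sub₀ hi, zpow_sub₀ hj, zpow_one]
    generalize algebraMap k F q = Q at *
    generalize z i ^ m = A, z i ^ n = B, z j ^ m = C, z j ^ n = D
    generalize z i = Z, z j = Y at *
    rcases h with ⟨h, rfl⟩ | ⟨h, rfl⟩ <;>
    simp only [h, h.not_gt, if_true, if_false, zpow_zero, zpow_one] <;> field_simp <;> ring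

lemma degVec_first_base₀ {x' y' : ℤ} (x n δ : ℤ) (h : x' < y' ∧ δ = 0 ∨ y' < x' ∧ δ = 1) :
    V x x x' y' (n + δ) n + q • V x x y' x' n (n + δ) = 0 := by
  have hxy : x' ≠ y' := by omega
  have hd : z i - z j ≠ 0 := sub_ne_zero.2 (hz.ne hij)
  have hi := hz0 i
  have hj := hz0 j
  have hQ : algebraMap k F q ≠ 0 := by simpa using hq
  have key := heckeDiff_same_first (a₀ := a₀) (b₀ := b₀) (z := z) (q := q) (x := x) hij hxy
    (σ := σ)
    (f₁ := z i ^ (n + δ) * z j ^ n * R)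
    (f₂ := q • (z i ^ n * z j ^ (n + δ) * R)) ?_ ?_
  · simp only [map_sub, map_add, map_neg, map_smul, map_zero] at key
    unfold degVec
    linear_combination (norm := module) key
  all_goals
    simp only [map_sub, map_add, map_neg, map_smul, map_zero, dd_apply, exch_deg hσ hR]
    simp only [Algebra.smul_def, map_sub, map_inv₀, map_pow, map_one, zpow_add₀ hi, zpow_add₀ hj,
      zpow_sub₀ hi, zpow_sub₀ hj, zpow_one]
    generalize algebraMap k F q = Q at *
    generalize z i ^ n = B, z j ^ n = D
    generalize z i = Z, z j = Y at *
    rcases h with ⟨h, rfl⟩ | ⟨h, rfl⟩ <;>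
    simp only [h, h.not_gt, if_true, if_false, zpow_zero, zpow_one] <;> field_simp <;> ring

lemma degVec_first_base₁ {x' y' : ℤ} (x n δ : ℤ) (h : x' < y' ∧ δ = 0 ∨ y' < x' ∧ δ = 1) :
    V x x x' y' (n + δ + 1) n + q • V x x y' x' n (n + δ + 1) =
      (q ^ 2 - 1) • V x x x' y' (n + δ) (n + 1) := by
  have hxy : x' ≠ y' := by omega
  have hd : z i - z j ≠ 0 := sub_ne_zero.2 (hz.ne hij)
  have hi := hz0 i
  have hj := hz0 j
  have hQ : algebraMap k F q ≠ 0 := by simpa using hq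
  have key := heckeDiff_same_first (a₀ := a₀) (b₀ := b₀) (z := z) (q := q) (x := x) hij hxy
    (σ := σ)
    (f₁ := z i ^ (n + δ + 1) * z j ^ n * R -
      (q ^ 2 - 1) • (z i ^ (n + δ) * z j ^ (n + 1) * R))
    (f₂ := q • (z i ^ n * z j ^ (n + δ + 1) * R)) ?_ ?_
  · simp only [map_sub, map_add, map_neg, map_smul, map_zero] at key
    unfold degVec
    linear_combination (norm := module) key
  all_goals
    simp only [map_sub, map_add, map_neg, map_smul, map_zero, dd_apply, exch_deg hσ hR]
    simp only [Algebra.smul_def, map_sub, map_inv₀, map_pow, map_one, zpow_add₀ hi, zpow_add₀ hj,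
      zpow_sub₀ hi, zpow_sub₀ hj, zpow_one]
    generalize algebraMap k F q = Q at *
    generalize z i ^ n = B, z j ^ n = D
    generalize z i = Z, z j = Y at *
    rcases h with ⟨h, rfl⟩ | ⟨h, rfl⟩ <;>
    simp only [h, h.not_gt, if_true, if_false, zpow_zero, zpow_one] <;> field_simp <;> ring

lemma degVec_four_rec {x y x' y' : ℤ} (m n δ ε : ℤ) (h : x < y ∧ δ = 0 ∨ y < x ∧ δ = 1)
    (h' : x' < y' ∧ ε = 0 ∨ y' < x' ∧ ε = 1) :
    V x y x' y' m n + (q - q⁻¹) • V x y y' x' (m - ε) (n + ε) + V y x y' x' n m +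
      (q - q⁻¹) • V x y y' x' (n + δ) (m - δ) =
    V y x y' x' (n + 1) (m - 1) + V x y x' y' (m - 1) (n + 1) := by
  have hxy : x ≠ y := by omega
  have hxy' : x' ≠ y' := by omega
  have hd : z i - z j ≠ 0 := sub_ne_zero.2 (hz.ne hij)
  have hi := hz0 i
  have hj := hz0 j
  have hQ : algebraMap k F q ≠ 0 := by simpa using hq
  have key := heckeDiff_four_colours (a₀ := a₀) (b₀ := b₀) (z := z) (q := q) hij hxy hxy'
    (σ := σ)
    (f₁ := z i ^ m * z j ^ n * R - z i ^ (m - 1) * z j ^ (n + 1) * R)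
    (f₂ := z i ^ n * z j ^ m * R - z i ^ (n + 1) * z j ^ (m - 1) * R)
    (f₃ := 0)
    (f₄ := (q - q⁻¹) • (z i ^ (m - ε) * z j ^ (n + ε) * R) +
      (q - q⁻¹) • (z i ^ (n + δ) * z j ^ (m - δ) * R)) ?_ ?_ ?_ ?_
  · simp only [map_sub, map_add, map_neg, map_smul, map_zero] at key
    unfold degVec
    linear_combination (norm := module) key
  all_goals
    simp only [map_sub, map_add, map_neg, map_smul, map_zero, dd_apply, exch_deg hσ hR]
    simp only [Algebra.smul_def, map_sub, map_inv₀, map_pow, map_one, zpow_add₀ hi, zpow_add₀ hj,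
      zpow_sub₀ hi, zpow_sub₀ hj, zpow_one]
    generalize algebraMap k F q = Q at *
    generalize z i ^ m = A, z i ^ n = B, z j ^ m = C, z j ^ n = D
    generalize z i = Z, z j = Y at *
    rcases h with ⟨h, rfl⟩ | ⟨h, rfl⟩ <;> rcases h' with ⟨h', rfl⟩ | ⟨h', rfl⟩ <;>
    simp only [h, h.not_gt, h', h'.not_gt, if_true, if_false, zpow_zero, zpow_one] <;>
    field_simp <;> ring

lemma degVec_four_base_neg {x y x' y' : ℤ} (n δ ε : ℤ) (h : x < y ∧ δ = 0 ∨ y < x ∧ δ = 1)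
    (h' : x' < y' ∧ ε = 0 ∨ y' < x' ∧ ε = 1) :
    V x y x' y' (n + δ + ε - 1) n + V y x y' x' n (n + δ + ε - 1) = 0 := by
  have hxy : x ≠ y := by omega
  have hxy' : x' ≠ y' := by omega
  have hd : z i - z j ≠ 0 := sub_ne_zero.2 (hz.ne hij)
  have hi := hz0 i
  have hj := hz0 j
  have hQ : algebraMap k F q ≠ 0 := by simpa using hq
  have key := heckeDiff_four_colours (a₀ := a₀) (b₀ := b₀) (z := z) (q := q) hij hxy hxy'
    (σ := σ)
    (f₁ := z i ^ (n + δ + ε - 1) * z j ^ n * R)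
    (f₂ := z i ^ n * z j ^ (n + δ + ε - 1) * R)
    (f₃ := 0)
    (f₄ := 0) ?_ ?_ ?_ ?_
  · simp only [map_sub, map_add, map_neg, map_smul, map_zero] at key
    unfold degVec
    linear_combination (norm := module) key
  all_goals
    simp only [map_sub, map_add, map_neg, map_smul, map_zero, dd_apply, exch_deg hσ hR]
    simp only [Algebra.smul_def, map_sub, map_inv₀, map_pow, map_one, zpow_add₀ hi, zpow_add₀ hj,
      zpow_sub₀ hi, zpow_sub₀ hj, zpow_one]
    generalize algebraMap k F q = Q at *
    generalize z i ^ n = B, z j ^ n = D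
    generalize z i = Z, z j = Y at *
    rcases h with ⟨h, rfl⟩ | ⟨h, rfl⟩ <;> rcases h' with ⟨h', rfl⟩ | ⟨h', rfl⟩ <;>
    simp only [h, h.not_gt, h', h'.not_gt, if_true, if_false, zpow_zero, zpow_one] <;>
    field_simp <;> ring

lemma degVec_four_base₀_second {x y x' y' : ℤ} (n δ ε : ℤ) (h : x < y ∧ δ = 0 ∨ y < x ∧ δ = 1)
    (h' : x' < y' ∧ ε = 0 ∨ y' < x' ∧ ε = 1) :
    V x y x' y' (n + δ + ε) n + V y x y' x' n (n + δ + ε) =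
      (q - q⁻¹) • V y x x' y' (n + ε) (n + δ) := by
  have hxy : x ≠ y := by omega
  have hxy' : x' ≠ y' := by omega
  have hd : z i - z j ≠ 0 := sub_ne_zero.2 (hz.ne hij)
  have hi := hz0 i
  have hj := hz0 j
  have hQ : algebraMap k F q ≠ 0 := by simpa using hq
  have key := heckeDiff_four_colours (a₀ := a₀) (b₀ := b₀) (z := z) (q := q) hij hxy hxy'
    (σ := σ)
    (f₁ := z i ^ (n + δ + ε) * z j ^ n * R)
    (f₂ := z i ^ n * z j ^ (n + δ + ε) * R)
    (f₃ := -((q - q⁻¹) • (z i ^ (n + ε) * z j ^ (n + δ) * R)))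
    (f₄ := 0) ?_ ?_ ?_ ?_
  · simp only [map_sub, map_add, map_neg, map_smul, map_zero] at key
    unfold degVec
    linear_combination (norm := module) key
  all_goals
    simp only [map_sub, map_add, map_neg, map_smul, map_zero, dd_apply, exch_deg hσ hR]
    simp only [Algebra.smul_def, map_sub, map_inv₀, map_pow, map_one, zpow_add₀ hi, zpow_add₀ hj,
      zpow_sub₀ hi, zpow_sub₀ hj, zpow_one]
    generalize algebraMap k F q = Q at *
    generalize z i ^ n = B, z j ^ n = D
    generalize z i = Z, z j = Y at *
    rcases h with ⟨h, rfl⟩ | ⟨h, rfl⟩ <;> rcases h' with ⟨h', rfl⟩ | ⟨h', rfl⟩ <;>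
    simp only [h, h.not_gt, h', h'.not_gt, if_true, if_false, zpow_zero, zpow_one] <;>
    field_simp <;> ring

lemma degVec_four_base₀_first {x y x' y' : ℤ} (n δ ε : ℤ) (h : x < y ∧ δ = 0 ∨ y < x ∧ δ = 1)
    (h' : x' < y' ∧ ε = 0 ∨ y' < x' ∧ ε = 1) :
    V x y x' y' (n + δ + ε) n + V y x y' x' n (n + δ + ε) =
      -((q - q⁻¹) • V x y y' x' (n + δ) (n + ε)) := by
  have hxy : x ≠ y := by omega
  have hxy' : x' ≠ y' := by omega
  have hd : z i - z j ≠ 0 := sub_ne_zero.2 (hz.ne hij)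
  have hi := hz0 i
  have hj := hz0 j
  have hQ : algebraMap k F q ≠ 0 := by simpa using hq
  have key := heckeDiff_four_colours (a₀ := a₀) (b₀ := b₀) (z := z) (q := q) hij hxy hxy'
    (σ := σ)
    (f₁ := z i ^ (n + δ + ε) * z j ^ n * R)
    (f₂ := z i ^ n * z j ^ (n + δ + ε) * R)
    (f₃ := 0)
    (f₄ := (q - q⁻¹) • (z i ^ (n + δ) * z j ^ (n + ε) * R)) ?_ ?_ ?_ ?_
  · simp only [map_sub, map_add, map_neg, map_smul, map_zero] at key
    unfold degVec
    linear_combination (norm := module) key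
  all_goals
    simp only [map_sub, map_add, map_neg, map_smul, map_zero, dd_apply, exch_deg hσ hR]
    simp only [Algebra.smul_def, map_sub, map_inv₀, map_pow, map_one, zpow_add₀ hi, zpow_add₀ hj,
      zpow_sub₀ hi, zpow_sub₀ hj, zpow_one]
    generalize algebraMap k F q = Q at *
    generalize z i ^ n = B, z j ^ n = D
    generalize z i = Z, z j = Y at *
    rcases h with ⟨h, rfl⟩ | ⟨h, rfl⟩ <;> rcases h' with ⟨h', rfl⟩ | ⟨h', rfl⟩ <;>
    simp only [h, h.not_gt, h', h'.not_gt, if_true, if_false, zpow_zero, zpow_one] <;>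
    field_simp <;> ring

lemma degVec_four_base₁ {x y x' y' : ℤ} (n δ ε : ℤ) (h : x < y ∧ δ = 0 ∨ y < x ∧ δ = 1)
    (h' : x' < y' ∧ ε = 0 ∨ y' < x' ∧ ε = 1) :
    V x y x' y' (n + δ + ε + 1) n + V y x y' x' n (n + δ + ε + 1) =
      (q - q⁻¹) • V y x x' y' (n + ε) (n + δ + 1) - (q - q⁻¹) • V x y y' x' (n + δ) (n + ε + 1) +
        (q - q⁻¹) ^ 2 • V x y x' y' (n + δ + ε) (n + 1) := by
  have hxy : x ≠ y := by omega
  have hxy' : x' ≠ y' := by omega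
  have hd : z i - z j ≠ 0 := sub_ne_zero.2 (hz.ne hij)
  have hi := hz0 i
  have hj := hz0 j
  have hQ : algebraMap k F q ≠ 0 := by simpa using hq
  have key := heckeDiff_four_colours (a₀ := a₀) (b₀ := b₀) (z := z) (q := q) hij hxy hxy'
    (σ := σ)
    (f₁ := z i ^ (n + δ + ε + 1) * z j ^ n * R -
      (q - q⁻¹) ^ 2 • (z i ^ (n + δ + ε) * z j ^ (n + 1) * R))
    (f₂ := z i ^ n * z j ^ (n + δ + ε + 1) * R)
    (f₃ := -((q - q⁻¹) • (z i ^ (n + ε) * z j ^ (n + δ + 1) * R)))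
    (f₄ := (q - q⁻¹) • (z i ^ (n + δ) * z j ^ (n + ε + 1) * R)) ?_ ?_ ?_ ?_
  · simp only [map_sub, map_add, map_neg, map_smul, map_zero] at key
    unfold degVec
    linear_combination (norm := module) key
  all_goals
    simp only [map_sub, map_add, map_neg, map_smul, map_zero, dd_apply, exch_deg hσ hR]
    simp only [Algebra.smul_def, map_sub, map_inv₀, map_pow, map_one, zpow_add₀ hi, zpow_add₀ hj,
      zpow_sub₀ hi, zpow_sub₀ hj, zpow_one]
    generalize algebraMap k F q = Q at *
    generalize z i ^ n = B, z j ^ n = D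
    generalize z i = Z, z j = Y at *
    rcases h with ⟨h, rfl⟩ | ⟨h, rfl⟩ <;> rcases h' with ⟨h', rfl⟩ | ⟨h', rfl⟩ <;>
    simp only [h, h.not_gt, h', h'.not_gt, if_true, if_false, zpow_zero, zpow_one] <;>
    field_simp <;> ring

end

end LocalRelations

section Straightening

variable {k M : Type*} [Field k] [AddCommGroup M] [Module k M] (w : ℤ → ℤ → M) (N : ℤ)

/-- The sum of `f m • w (x - N m) (y + N m)` over the indices for which the first argument
exceeds the second. -/
def chainSum (x y : ℤ) (f : ℕ → k) : M :=
  ∑ m ∈ Finset.range (x - y).toNat,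
    if y + N * m < x - N * m then f m • w (x - N * m) (y + N * m) else 0

variable {N}

lemma sum_range_eq_chainSum (hN : 0 < N) (x y : ℤ) (f : ℕ → k) {n : ℕ} (hn : (x - y).toNat ≤ n) :
    ∑ m ∈ Finset.range n,
      (if y + N * m < x - N * m then f m • w (x - N * m) (y + N * m) else 0) =
        chainSum w N x y f := by
  refine (Finset.sum_subset (Finset.range_mono hn) fun m _ hm => if_neg ?_).symm
  rw [Finset.mem_range, not_lt] at hm
  have : (m : ℤ) ≤ N * m := le_mul_of_one_le_left (by positivity) hN
  omega

lemma chainSum_of_le {x y : ℤ} (h : x ≤ y) (f : ℕ → k) : chainSum w N x y f = 0 := by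
  rw [chainSum, Int.toNat_of_nonpos (by omega), Finset.range_zero, Finset.sum_empty]

lemma chainSum_of_lt (hN : 0 < N) {x y : ℤ} (h : y < x) (f : ℕ → k) :
    chainSum w N x y f = f 0 • w x y + chainSum w N (x - N) (y + N) fun m => f (m + 1) := by
  rw [← sum_range_eq_chainSum w hN x y f (Nat.le_succ _), Finset.sum_range_succ',
    ← sum_range_eq_chainSum w hN (x - N) (y + N) _ (n := (x - y).toNat) (by omega), add_comm]
  congr 1
  · simp [h]
  · refine Finset.sum_congr rfl fun m _ => ?_
    have h1 : x - N * (m + 1 : ℕ) = x - N - N * m := by push_cast; ring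
    have h2 : y + N * (m + 1 : ℕ) = y + N + N * m := by push_cast; ring
    rw [h1, h2]

lemma chainSum_sub (x y : ℤ) (f g : ℕ → k) :
    chainSum w N x y (fun m => f m - g m) = chainSum w N x y f - chainSum w N x y g := by
  rw [chainSum, chainSum, chainSum, ← Finset.sum_sub_distrib]
  refine Finset.sum_congr rfl fun m _ => ?_
  split_ifs
  · exact sub_smul _ _ _
  · rw [sub_zero]

lemma chainSum_smul (x y : ℤ) (c : k) (f : ℕ → k) :
    chainSum w N x y (fun m => c * f m) = c • chainSum w N x y f := by
  rw [chainSum, chainSum, Finset.smul_sum]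
  refine Finset.sum_congr rfl fun m _ => ?_
  split_ifs
  · exact mul_smul _ _ _
  · rw [smul_zero]

lemma chainSum_of_lt_of_le (hN : 0 < N) {x y : ℤ} (h : y < x) (h' : x - N ≤ y + N) (f : ℕ → k) :
    chainSum w N x y f = f 0 • w x y := by
  rw [chainSum_of_lt w hN h, chainSum_of_le w h', add_zero]

variable {w}

/-- A solution of the two-colour recurrence is given by the two-colour straightening formula. -/
lemma straighten_two_colours (p : k) {C : ℤ → ℤ → Prop} {γ : ℤ} (hγ : 0 < γ) (hγN : γ < N)
    (hC : ∀ t u, C t u → C (t + N) (u - N))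
    (rec : ∀ t u, C t u → w t u + p • w u t = (p ^ 2 - 1) • w (u - γ) (t + γ) +
      p • w (u - N) (t + N) + p ^ 2 • w (t + N) (u - N))
    (base₀ : ∀ t u, C t u → u = t + γ → w t u + p • w u t = 0)
    (base₁ : ∀ t u, C t u → u = t + γ + N →
      w t u + p • w u t = (p ^ 2 - 1) • w (u - γ) (t + γ))
    (n : ℕ) (t u : ℤ) (h : C t u) (hu : u = t + γ + N * n) :
    w t u = -(p • w u t) + (p ^ 2 - 1) • (chainSum w N (u - γ) (t + γ) (fun m => p ^ (2 * m)) -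
      chainSum w N (u - N) (t + N) fun m => p ^ (2 * m + 1)) := by
  have hN : 0 < N := hγ.trans hγN
  induction n using Nat.strong_induction_on generalizing t u with
  | _ n ih =>
  match n with
  | 0 =>
    rw [Nat.cast_zero, mul_zero, add_zero] at hu
    rw [chainSum_of_le w (by omega), chainSum_of_le w (by omega), sub_zero, smul_zero, add_zero]
    exact eq_neg_of_add_eq_zero_left (base₀ t u h hu)
  | 1 =>
    rw [Nat.cast_one, mul_one] at hu
    rw [chainSum_of_lt_of_le w hN (by omega) (by omega), chainSum_of_le w (by omega)]
    linear_combination (norm := module) base₁ t u h hu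
  | n + 2 =>
    have hn : 0 ≤ N * n := by positivity
    push_cast [mul_add] at hu
    have key := ih n (by omega) _ _ (hC t u h) (by omega)
    rw [chainSum_of_lt w hN (x := u - γ) (y := t + γ) (by omega),
      chainSum_of_lt w hN (x := u - N) (y := t + N) (by omega)]
    have e1 : (fun m : ℕ => p ^ (2 * (m + 1))) = fun m => p ^ 2 * p ^ (2 * m) := by
      ext m; ring
    have e2 : (fun m : ℕ => p ^ (2 * (m + 1) + 1)) = fun m => p ^ 2 * p ^ (2 * m + 1) := by
      ext m; ring
    rw [e1, e2, chainSum_smul, chainSum_smul]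
    rw [sub_right_comm, add_right_comm] at key
    linear_combination (norm := module) rec t u h + p ^ 2 • key

/-- A solution of the four-colour recurrence is given by the four-colour straightening formula. -/
lemma straighten_four_colours {c : k} {φ ψ : ℕ → k} (hφ₀ : φ 0 = 1) (hψ₀ : ψ 0 = c)
    (hφ : ∀ m, φ (m + 1) = φ m + c * ψ m) (hψ : ∀ m, ψ (m + 1) = ψ m + c * φ (m + 1))
    {α : ℤ} (hα : 0 < α) (hαN : α < N) {C : ℤ → ℤ → ℤ → Prop}
    (hC : ∀ t u β, C t u β → C (t + N) (u - N) β)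
    (hC' : ∀ t u β, C t u β → C (t + β) (u - β) (N - β))
    (hβ : ∀ t u β, C t u β → 0 < β ∧ β < N ∧ α ≠ β ∧ α + β ≠ N ∧
      ∃ n : ℤ, u = t + α + β + N * n)
    (rec : ∀ t u β, C t u β → w t u + c • w (t + β) (u - β) + w u t + c • w (u - α) (t + α) =
      w (u - N) (t + N) + w (t + N) (u - N))
    (base_neg : ∀ t u β, C t u β → u = t + α + β - N → w t u + w u t = 0)
    (base₀ : ∀ t u β, C t u β → u = t + α + β → w t u + w u t = c • w (u - β) (t + β))
    (base₀' : ∀ t u β, C t u β → u = t + α + β → w t u + w u t = -(c • w (u - α) (t + α)))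
    (base₁ : ∀ t u β, C t u β → u = t + α + β + N → w t u + w u t =
      c • w (u - β) (t + β) - c • w (u - α) (t + α) + c ^ 2 • w (u - α - β) (t + α + β))
    (t u β : ℤ) (h : C t u β) (htu : t ≤ u) :
    w t u = -w u t + c • chainSum w N (u - β) (t + β) φ - c • chainSum w N (u - α) (t + α) φ +
      c • chainSum w N (u - (α + β)) (t + (α + β)) ψ - c • chainSum w N (u - N) (t + N) ψ := by
  have hN : 0 < N := hα.trans hαN
  obtain ⟨n, hn⟩ : ∃ n : ℕ, (u - t).toNat = n := ⟨_, rfl⟩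
  induction n using Nat.strong_induction_on generalizing t u β with
  | _ n ih =>
  obtain ⟨hβ0, hβN, hne, hne', k', hk⟩ := hβ t u β h
  by_cases hlt : u - t < 2 * N
  · have hk1 : -2 < k' := by
      by_contra! hk'
      nlinarith
    have hk2 : k' < 2 := by
      by_contra! hk'
      nlinarith
    obtain rfl | rfl | rfl : k' = -1 ∨ k' = 0 ∨ k' = 1 := by omega
    · rw [chainSum_of_le w (by omega), chainSum_of_le w (by omega), chainSum_of_le w (by omega),
        chainSum_of_le w (by omega)]
      linear_combination (norm := module) base_neg t u β h (by omega)
    · rw [mul_zero, add_zero] at hk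
      rw [chainSum_of_le w (x := u - (α + β)) (by omega), chainSum_of_le w (x := u - N) (by omega)]
      rcases hne.lt_or_gt with hlt' | hlt'
      · rw [chainSum_of_le w (x := u - β) (by omega),
          chainSum_of_lt_of_le w hN (x := u - α) (by omega) (by omega), hφ₀]
        linear_combination (norm := module) base₀' t u β h hk
      · rw [chainSum_of_le w (x := u - α) (by omega),
          chainSum_of_lt_of_le w hN (x := u - β) (by omega) (by omega), hφ₀]
        linear_combination (norm := module) base₀ t u β h hk
    · rw [mul_one] at hk
      rw [chainSum_of_lt_of_le w hN (x := u - β) (by omega) (by omega),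
        chainSum_of_lt_of_le w hN (x := u - α) (by omega) (by omega),
        chainSum_of_lt_of_le w hN (x := u - (α + β)) (by omega) (by omega),
        chainSum_of_le w (x := u - N) (by omega), hφ₀, hψ₀, ← sub_sub, ← add_assoc]
      linear_combination (norm := module) base₁ t u β h hk
  · have k1 := ih _ (by omega) _ _ _ (hC t u β h) (by omega) rfl
    have k2 := ih _ (by omega) _ _ _ (hC' t u β h) (by omega) rfl
    have key := rec t u β h
    have shift (x y : ℤ) : chainSum w N x y ψ - c • chainSum w N x y φ =
        chainSum w N (x - N) (y + N) ψ := by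
      rw [← chainSum_smul, ← chainSum_sub]
      rcases lt_or_ge y x with hxy | hxy
      · rw [chainSum_of_lt w hN hxy]
        simp [hφ₀, hψ₀, hψ]
      · rw [chainSum_of_le w hxy, chainSum_of_le w (by omega)]
    have shift' {x y : ℤ} (hxy : y < x) : chainSum w N x y φ = w x y +
        chainSum w N (x - N) (y + N) φ + c • chainSum w N (x - N) (y + N) ψ := by
      rw [chainSum_of_lt w hN hxy, hφ₀, one_smul, add_assoc]
      have e : (fun m => φ (m + 1)) = fun m => φ (m + 1) - c * ψ m + c * ψ m := by ext; ring
      rw [← chainSum_smul w _ _ c ψ]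
      have := chainSum_sub w (N := N) (x - N) (y + N) (fun m => φ (m + 1)) fun m => c * ψ m
      have e : (fun m => φ (m + 1) - c * ψ m) = φ := by ext; rw [hφ]; ring
      rw [e] at this
      rw [this]
      abel
    have s1 := shift' (x := u - β) (y := t + β) (by omega)
    have s2 := shift' (x := u - α) (y := t + α) (by omega)
    have s3 := shift (u - (α + β)) (t + (α + β))
    have s4 := shift (u - N) (t + N)
    rw [s1, s2]
    simp only [show u - β - (N - β) = u - N by ring, show t + β + (N - β) = t + N by ring,
      show u - β - α = u - (α + β) by ring, show t + β + α = t + (α + β) by ring,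
      show u - β - (α + (N - β)) = u - α - N by ring,
      show t + β + (α + (N - β)) = t + α + N by ring] at k2
    simp only [show u - N - β = u - β - N by ring, show t + N + β = t + β + N by ring,
      show u - N - α = u - α - N by ring, show t + N + α = t + α + N by ring,
      show u - N - (α + β) = u - (α + β) - N by ring,
      show t + N + (α + β) = t + (α + β) + N by ring] at k1
    linear_combination (norm := module) key + k1 - c • k2 - c • s3 + c • s4

end Straightening

section PairRelations

open Equiv

lemma linearCombination_pairSum_zero {M : Type*} [AddCommGroup M] [Module K M] (w : ℤ → ℤ → M)
    {N γ : ℤ} (hN : 0 < N) (hγ : 0 ≤ γ) (t u : ℤ) (f : ℕ → K) :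
    Finsupp.linearCombination K (fun p : ℤ × ℤ => w p.1 p.2) (pairSum N t u γ 0 f) =
      chainSum w N (u - γ) (t + γ) f := by
  rw [← sum_range_eq_chainSum w hN _ _ _ (n := (u - t).toNat + 1) (by omega), pairSum, map_sum,
    Nat.Ico_zero_eq_range]
  refine Finset.sum_congr rfl fun m _ => ?_
  split_ifs <;> simp [pairTerm]

lemma linearCombination_pairSum_one {M : Type*} [AddCommGroup M] [Module K M] (w : ℤ → ℤ → M)
    {N : ℤ} (hN : 0 < N) (t u : ℤ) (f : ℕ → K) :
    Finsupp.linearCombination K (fun p : ℤ × ℤ => w p.1 p.2) (pairSum N t u 0 1 f) =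
      chainSum w N (u - N) (t + N) fun m => f (m + 1) := by
  rw [← sum_range_eq_chainSum w hN _ _ _ (n := (u - t).toNat) (by omega), pairSum, map_sum,
    Finset.sum_Ico_eq_sum_range]
  refine Finset.sum_congr rfl fun m _ => ?_
  have h1 : u - 0 - N * (1 + m : ℕ) = u - N - N * m := by push_cast; ring
  have h2 : t + 0 + N * (1 + m : ℕ) = t + N + N * m := by push_cast; ring
  rw [h1, h2, add_comm 1 m]
  split_ifs <;> simp [pairTerm]

variable {F ι : Type*} [Field F] [Algebra K F] [DecidableEq ι] [Fintype ι] {i j : ι}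
  {σ : Perm ι →* (F ≃ₐ[K] F)} {z : ι → F} {a₀ b₀ : ι → ℤ} {e r : ℤ}

variable (σ z a₀ b₀ e r) in
/-- The image under `heckeDiff` of the vector attached to the integers `t, u` at the
sites `i, j`. -/
def pairVec (R : F) (i j : ι) (t u : ℤ) : (ι → ℤ) → (ι → ℤ) → F :=
  degVec K σ z qK a₀ b₀ R i j (aFun e t) (aFun e u) (bFun e r t) (bFun e r u)
    (mFun e r t) (mFun e r u)

variable {R : F}

lemma pairVec_colourEnc {a b m a' b' m' : ℤ} (ha : 1 ≤ a ∧ a ≤ e) (hb : 1 ≤ b ∧ b ≤ r)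
    (ha' : 1 ≤ a' ∧ a' ≤ e) (hb' : 1 ≤ b' ∧ b' ≤ r) :
    pairVec σ z a₀ b₀ e r R i j (colourEnc e r a b m) (colourEnc e r a' b' m') =
      degVec K σ z qK a₀ b₀ R i j a a' b b' m m' := by
  rw [pairVec, aFun_colourEnc ha.1 ha.2, bFun_colourEnc ha.1 ha.2 hb.1 hb.2,
    mFun_colourEnc ha.1 ha.2 hb.1 hb.2, aFun_colourEnc ha'.1 ha'.2,
    bFun_colourEnc ha'.1 ha'.2 hb'.1 hb'.2, mFun_colourEnc ha'.1 ha'.2 hb'.1 hb'.2]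

lemma qK_ne_zero : qK ≠ 0 := RatFunc.X_ne_zero

lemma qK_add_inv_ne_zero : qK + qK⁻¹ ≠ 0 := by
  have h0 := qK_ne_zero
  intro h
  have h2 : qK ^ 2 + 1 = 0 := by
    have := congrArg (qK * ·) h
    simp only [mul_add, mul_inv_cancel₀ h0, mul_zero] at this
    rw [sq, this]
  have h3 : algebraMap (Polynomial ℚ) K (Polynomial.X ^ 2 + 1) = 0 := by
    simpa [qK] using h2
  rw [map_eq_zero_iff _ (RatFunc.algebraMap_injective ℚ)] at h3
  have := congrArg (Polynomial.eval 0) h3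
  simp at this

variable (hσ : ∀ g i, σ g (z i) = z (g i)) (hz : Function.Injective z) (hz0 : ∀ i, z i ≠ 0)
  (hij : i ≠ j) (hR : σ (swap i j) R = R) (he : 0 < e) (hr : 0 < r)

local notation "W" => pairVec σ z a₀ b₀ e r R i j

include hσ hz hz0 hij hR

lemma pairVec_second {a a' b m n δ : ℤ} (ha : 1 ≤ a ∧ a ≤ e) (ha' : 1 ≤ a' ∧ a' ≤ e)
    (hb : 1 ≤ b ∧ b ≤ r) (h : a < a' ∧ δ = 0 ∨ a' < a ∧ δ = 1) {t u : ℤ}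
    (ht : t = colourEnc e r a b m) (hu : u = colourEnc e r a' b n) (htu : t ≤ u) :
    W t u = -(qK⁻¹ • W u t) + (qK⁻¹ ^ 2 - 1) •
      (chainSum W (e * r) (u - (a' - a + e * r * δ)) (t + (a' - a + e * r * δ))
          (fun m => qK⁻¹ ^ (2 * m)) -
        chainSum W (e * r) (u - e * r) (t + e * r) fun m => qK⁻¹ ^ (2 * m + 1)) := by
  have he : 0 < e := by omega
  have hr : 0 < r := by omega
  have hN : 0 < e * r := mul_pos he hr
  have hN' : e ≤ e * r := le_mul_of_one_le_right he.le hr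
  have hγ : 0 < a' - a + e * r * δ ∧ a' - a + e * r * δ < e * r := by
    rcases h with ⟨h, rfl⟩ | ⟨h, rfl⟩ <;> simp only [mul_zero, mul_one] <;> omega
  have hk : u - t = a' - a + e * r * δ + e * r * (m - n - δ) := by
    rw [ht, hu, colourEnc, colourEnc]; ring
  have hk0 : 0 ≤ m - n - δ := by
    by_contra! hlt
    nlinarith
  obtain ⟨d, hd⟩ := Int.eq_ofNat_of_zero_le hk0
  refine straighten_two_colours (N := e * r) qK⁻¹ hγ.1 hγ.2
    (C := fun t u => ∃ m n, t = colourEnc e r a b m ∧ u = colourEnc e r a' b n)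
    ?_ ?_ ?_ ?_ d t u ⟨m, n, ht, hu⟩ (by rw [← hd]; linarith)
  · rintro _ _ ⟨m, n, rfl, rfl⟩
    exact ⟨m - 1, n + 1, by unfold colourEnc; ring, by unfold colourEnc; ring⟩
  · rintro _ _ ⟨m, n, rfl, rfl⟩
    rw [show colourEnc e r a' b n - (a' - a + e * r * δ) = colourEnc e r a b (n + δ) by
        unfold colourEnc; ring,
      show colourEnc e r a b m + (a' - a + e * r * δ) = colourEnc e r a' b (m - δ) by
        unfold colourEnc; ring,
      show colourEnc e r a b m + e * r = colourEnc e r a b (m - 1) by unfold colourEnc; ring,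
      show colourEnc e r a' b n - e * r = colourEnc e r a' b (n + 1) by unfold colourEnc; ring]
    simp only [pairVec_colourEnc, ha, ha', hb, and_self]
    exact degVec_second_rec hσ hz hz0 qK_ne_zero hij hR b m n δ h
  · rintro _ _ ⟨m, n, rfl, rfl⟩ hmn
    obtain rfl : m = n + δ := mul_left_cancel₀ hN.ne' (by unfold colourEnc at hmn; linarith)
    simp only [pairVec_colourEnc, ha, ha', hb, and_self]
    exact degVec_second_base₀ hσ hz hz0 qK_ne_zero hij hR b n δ h
  · rintro _ _ ⟨m, n, rfl, rfl⟩ hmn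
    obtain rfl : m = n + δ + 1 := mul_left_cancel₀ hN.ne' (by unfold colourEnc at hmn; linarith)
    rw [show colourEnc e r a' b n - (a' - a + e * r * δ) = colourEnc e r a b (n + δ) by
        unfold colourEnc; ring,
      show colourEnc e r a b (n + δ + 1) + (a' - a + e * r * δ) = colourEnc e r a' b (n + 1) by
        unfold colourEnc; ring]
    simp only [pairVec_colourEnc, ha, ha', hb, and_self]
    exact degVec_second_base₁ hσ hz hz0 qK_ne_zero hij hR b n δ h

lemma pairVec_first {a b b' m n δ : ℤ} (ha : 1 ≤ a ∧ a ≤ e) (hb : 1 ≤ b ∧ b ≤ r)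
    (hb' : 1 ≤ b' ∧ b' ≤ r) (h : b < b' ∧ δ = 0 ∨ b' < b ∧ δ = 1) {t u : ℤ}
    (ht : t = colourEnc e r a b m) (hu : u = colourEnc e r a b' n) (htu : t ≤ u) :
    W t u = -(qK • W u t) + (qK ^ 2 - 1) •
      (chainSum W (e * r) (u - (e * (b' - b) + e * r * δ)) (t + (e * (b' - b) + e * r * δ))
          (fun m => qK ^ (2 * m)) -
        chainSum W (e * r) (u - e * r) (t + e * r) fun m => qK ^ (2 * m + 1)) := by
  have he : 0 < e := by omega
  have hr : 0 < r := by omega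
  have hN : 0 < e * r := mul_pos he hr
  have hγ : 0 < e * (b' - b) + e * r * δ ∧ e * (b' - b) + e * r * δ < e * r := by
    rw [mul_assoc, ← mul_add]
    refine ⟨mul_pos he ?_, mul_lt_mul_of_pos_left ?_ he⟩ <;>
    rcases h with ⟨h, rfl⟩ | ⟨h, rfl⟩ <;> simp only [mul_zero, mul_one] <;> omega
  have hk : u - t = e * (b' - b) + e * r * δ + e * r * (m - n - δ) := by
    rw [ht, hu, colourEnc, colourEnc]; ring
  have hk0 : 0 ≤ m - n - δ := by
    by_contra! hlt
    nlinarith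
  obtain ⟨d, hd⟩ := Int.eq_ofNat_of_zero_le hk0
  refine straighten_two_colours (N := e * r) qK hγ.1 hγ.2
    (C := fun t u => ∃ m n, t = colourEnc e r a b m ∧ u = colourEnc e r a b' n)
    ?_ ?_ ?_ ?_ d t u ⟨m, n, ht, hu⟩ (by rw [← hd]; linarith)
  · rintro _ _ ⟨m, n, rfl, rfl⟩
    exact ⟨m - 1, n + 1, by unfold colourEnc; ring, by unfold colourEnc; ring⟩
  · rintro _ _ ⟨m, n, rfl, rfl⟩
    rw [show colourEnc e r a b' n - (e * (b' - b) + e * r * δ) = colourEnc e r a b (n + δ) by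
        unfold colourEnc; ring,
      show colourEnc e r a b m + (e * (b' - b) + e * r * δ) = colourEnc e r a b' (m - δ) by
        unfold colourEnc; ring,
      show colourEnc e r a b m + e * r = colourEnc e r a b (m - 1) by unfold colourEnc; ring,
      show colourEnc e r a b' n - e * r = colourEnc e r a b' (n + 1) by unfold colourEnc; ring]
    simp only [pairVec_colourEnc, ha, hb, hb', and_self]
    exact degVec_first_rec hσ hz hz0 qK_ne_zero hij hR a m n δ h
  · rintro _ _ ⟨m, n, rfl, rfl⟩ hmn
    obtain rfl : m = n + δ := mul_left_cancel₀ hN.ne' (by unfold colourEnc at hmn; linarith)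
    simp only [pairVec_colourEnc, ha, hb, hb', and_self]
    exact degVec_first_base₀ hσ hz hz0 qK_ne_zero hij hR a n δ h
  · rintro _ _ ⟨m, n, rfl, rfl⟩ hmn
    obtain rfl : m = n + δ + 1 := mul_left_cancel₀ hN.ne' (by unfold colourEnc at hmn; linarith)
    rw [show colourEnc e r a b' n - (e * (b' - b) + e * r * δ) = colourEnc e r a b (n + δ) by
        unfold colourEnc; ring,
      show colourEnc e r a b (n + δ + 1) + (e * (b' - b) + e * r * δ) =
        colourEnc e r a b' (n + 1) by unfold colourEnc; ring]
    simp only [pairVec_colourEnc, ha, hb, hb', and_self]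
    exact degVec_first_base₁ hσ hz hz0 qK_ne_zero hij hR a n δ h

lemma pairVec_four {a a' b b' m n δ ε : ℤ} (ha : 1 ≤ a ∧ a ≤ e) (ha' : 1 ≤ a' ∧ a' ≤ e)
    (hb : 1 ≤ b ∧ b ≤ r) (hb' : 1 ≤ b' ∧ b' ≤ r) (h : a < a' ∧ δ = 0 ∨ a' < a ∧ δ = 1)
    (h' : b < b' ∧ ε = 0 ∨ b' < b ∧ ε = 1) {α β : ℤ} (hα : α = a' - a + e * r * δ)
    (hβ : β = e * (b' - b) + e * r * ε) {φ ψ : ℕ → K} (hφ₀ : φ 0 = 1) (hψ₀ : ψ 0 = qK - qK⁻¹)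
    (hφ : ∀ m, φ (m + 1) = φ m + (qK - qK⁻¹) * ψ m)
    (hψ : ∀ m, ψ (m + 1) = ψ m + (qK - qK⁻¹) * φ (m + 1)) {t u : ℤ}
    (ht : t = colourEnc e r a b m) (hu : u = colourEnc e r a' b' n) (htu : t ≤ u) :
    W t u = -W u t + (qK - qK⁻¹) • chainSum W (e * r) (u - β) (t + β) φ -
      (qK - qK⁻¹) • chainSum W (e * r) (u - α) (t + α) φ +
      (qK - qK⁻¹) • chainSum W (e * r) (u - (α + β)) (t + (α + β)) ψ -
      (qK - qK⁻¹) • chainSum W (e * r) (u - e * r) (t + e * r) ψ := by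
  have he : 0 < e := by omega
  have hr : 0 < r := by omega
  have hN : 0 < e * r := mul_pos he hr
  have hN' : e ≤ e * r := le_mul_of_one_le_right he.le hr
  have hα' : 0 < α ∧ α < e * r := by
    rw [hα]
    rcases h with ⟨h, rfl⟩ | ⟨h, rfl⟩ <;> simp only [mul_zero, mul_one] <;> omega
  have hdvd (c : ℤ) : a' - a ≠ e * c := fun hc => by
    have h0 := Int.eq_zero_of_abs_lt_dvd ⟨c, hc⟩ (by rw [abs_lt]; omega)
    omega
  refine straighten_four_colours (N := e * r) hφ₀ hψ₀ hφ hψ hα'.1 hα'.2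
    (C := fun t u β => ∃ b b' m n ε, (1 ≤ b ∧ b ≤ r) ∧ (1 ≤ b' ∧ b' ≤ r) ∧
      (b < b' ∧ ε = 0 ∨ b' < b ∧ ε = 1) ∧ β = e * (b' - b) + e * r * ε ∧
      t = colourEnc e r a b m ∧ u = colourEnc e r a' b' n)
    ?_ ?_ ?_ ?_ ?_ ?_ ?_ ?_ t u β ⟨b, b', m, n, ε, hb, hb', h', hβ, ht, hu⟩ htu
  · rintro _ _ _ ⟨b, b', m, n, ε, hb, hb', h', rfl, rfl, rfl⟩
    exact ⟨b, b', m - 1, n + 1, ε, hb, hb', h', rfl, by unfold colourEnc; ring,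
      by unfold colourEnc; ring⟩
  · rintro _ _ _ ⟨b, b', m, n, ε, hb, hb', h', rfl, rfl, rfl⟩
    exact ⟨b', b, m - ε, n + ε, 1 - ε, hb', hb, by omega, by ring, by unfold colourEnc; ring,
      by unfold colourEnc; ring⟩
  · rintro _ _ _ ⟨b, b', m, n, ε, hb, hb', h', rfl, rfl, rfl⟩
    have hβ' : 0 < e * (b' - b) + e * r * ε ∧ e * (b' - b) + e * r * ε < e * r := by
      rw [mul_assoc, ← mul_add]
      refine ⟨mul_pos he ?_, mul_lt_mul_of_pos_left ?_ he⟩ <;>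
      rcases h' with ⟨h, rfl⟩ | ⟨h, rfl⟩ <;> simp only [mul_zero, mul_one] <;> omega
    refine ⟨hβ'.1, hβ'.2, fun heq => hdvd (b' - b + r * ε - r * δ) ?_,
      fun heq => hdvd (r - (b' - b) - r * ε - r * δ) ?_, m - n - δ - ε, ?_⟩
    · rw [hα] at heq
      linear_combination heq
    · rw [hα] at heq
      linear_combination heq
    · rw [hα, colourEnc, colourEnc]
      ring
  all_goals
    rintro _ _ _ ⟨b, b', m, n, ε, hb, hb', h', rfl, rfl, rfl⟩
    rw [hα]
  · rw [show colourEnc e r a' b' n - (a' - a + e * r * δ) = colourEnc e r a b' (n + δ) by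
        unfold colourEnc; ring,
      show colourEnc e r a b m + (a' - a + e * r * δ) = colourEnc e r a' b (m - δ) by
        unfold colourEnc; ring,
      show colourEnc e r a' b' n - (e * (b' - b) + e * r * ε) = colourEnc e r a' b (n + ε) by
        unfold colourEnc; ring,
      show colourEnc e r a b m + (e * (b' - b) + e * r * ε) = colourEnc e r a b' (m - ε) by
        unfold colourEnc; ring,
      show colourEnc e r a b m + e * r = colourEnc e r a b (m - 1) by unfold colourEnc; ring,
      show colourEnc e r a' b' n - e * r = colourEnc e r a' b' (n + 1) by unfold colourEnc; ring]
    simp only [pairVec_colourEnc, ha, ha', hb, hb', and_self]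
    exact degVec_four_rec hσ hz hz0 qK_ne_zero hij hR m n δ ε h h'
  · intro hmn
    obtain rfl : m = n + δ + ε - 1 :=
      mul_left_cancel₀ hN.ne' (by unfold colourEnc at hmn; linarith)
    simp only [pairVec_colourEnc, ha, ha', hb, hb', and_self]
    exact degVec_four_base_neg hσ hz hz0 qK_ne_zero hij hR n δ ε h h'
  · intro hmn
    obtain rfl : m = n + δ + ε := mul_left_cancel₀ hN.ne' (by unfold colourEnc at hmn; linarith)
    rw [show colourEnc e r a' b' n - (e * (b' - b) + e * r * ε) = colourEnc e r a' b (n + ε) by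
        unfold colourEnc; ring,
      show colourEnc e r a b (n + δ + ε) + (e * (b' - b) + e * r * ε) =
        colourEnc e r a b' (n + δ) by unfold colourEnc; ring]
    simp only [pairVec_colourEnc, ha, ha', hb, hb', and_self]
    exact degVec_four_base₀_second hσ hz hz0 qK_ne_zero hij hR n δ ε h h'
  · intro hmn
    obtain rfl : m = n + δ + ε := mul_left_cancel₀ hN.ne' (by unfold colourEnc at hmn; linarith)
    rw [show colourEnc e r a' b' n - (a' - a + e * r * δ) = colourEnc e r a b' (n + δ) by
        unfold colourEnc; ring,
      show colourEnc e r a b (n + δ + ε) + (a' - a + e * r * δ) =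
        colourEnc e r a' b (n + ε) by unfold colourEnc; ring]
    simp only [pairVec_colourEnc, ha, ha', hb, hb', and_self]
    exact degVec_four_base₀_first hσ hz hz0 qK_ne_zero hij hR n δ ε h h'
  · intro hmn
    obtain rfl : m = n + δ + ε + 1 :=
      mul_left_cancel₀ hN.ne' (by unfold colourEnc at hmn; linarith)
    rw [show colourEnc e r a' b' n - (a' - a + e * r * δ) - (e * (b' - b) + e * r * ε) =
        colourEnc e r a b (n + δ + ε) by unfold colourEnc; ring,
      show colourEnc e r a b (n + δ + ε + 1) + (a' - a + e * r * δ) + (e * (b' - b) + e * r * ε) =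
        colourEnc e r a' b' (n + 1) by unfold colourEnc; ring,
      show colourEnc e r a' b' n - (a' - a + e * r * δ) = colourEnc e r a b' (n + δ) by
        unfold colourEnc; ring,
      show colourEnc e r a b (n + δ + ε + 1) + (a' - a + e * r * δ) =
        colourEnc e r a' b (n + ε + 1) by unfold colourEnc; ring,
      show colourEnc e r a' b' n - (e * (b' - b) + e * r * ε) = colourEnc e r a' b (n + ε) by
        unfold colourEnc; ring,
      show colourEnc e r a b (n + δ + ε + 1) + (e * (b' - b) + e * r * ε) =
        colourEnc e r a b' (n + δ + 1) by unfold colourEnc; ring]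
    simp only [pairVec_colourEnc, ha, ha', hb, hb', and_self]
    exact degVec_four_base₁ hσ hz hz0 qK_ne_zero hij hR n δ ε h h'

end PairRelations

section PairFormula

open Equiv

variable {F ι : Type*} [Field F] [Algebra K F] [DecidableEq ι] [Fintype ι] {i j : ι}
  {σ : Perm ι →* (F ≃ₐ[K] F)} {z : ι → F} {a₀ b₀ : ι → ℤ} {e r : ℤ} {R : F}

lemma pairVec_eq_linearCombination_pairRHS (hσ : ∀ g i, σ g (z i) = z (g i))
    (hz : Function.Injective z) (hz0 : ∀ i, z i ≠ 0) (hij : i ≠ j) (hR : σ (swap i j) R = R)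
    (he : 0 < e) (hr : 0 < r) {t u : ℤ} (htu : t ≤ u) :
    pairVec σ z a₀ b₀ e r R i j t u = Finsupp.linearCombination K
      (fun p : ℤ × ℤ => pairVec σ z a₀ b₀ e r R i j p.1 p.2) (pairRHS e r t u) := by
  have hN : 0 < e * r := mul_pos he hr
  have hN' : e ≤ e * r := le_mul_of_one_le_right he.le hr
  obtain ⟨a, b, m, ha, ha', hb, hb', ht⟩ := colourEnc_surjective he hr t
  obtain ⟨a', b', n, hc, hc', hd, hd', hu⟩ := colourEnc_surjective he hr u
  have hat : aFun e t = a := by rw [ht, aFun_colourEnc ha ha']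
  have hau : aFun e u = a' := by rw [hu, aFun_colourEnc hc hc']
  have hbt : bFun e r t = b := by rw [ht, bFun_colourEnc ha ha' hb hb']
  have hbu : bFun e r u = b' := by rw [hu, bFun_colourEnc hc hc' hd hd']
  have hq0 := qK_ne_zero
  have hq1 := qK_add_inv_ne_zero
  obtain ⟨α, hα⟩ : ∃ α, (a' - a) % (e * r) = α := ⟨_, rfl⟩
  obtain ⟨β, hβ⟩ : ∃ β, (e * (b' - b)) % (e * r) = β := ⟨_, rfl⟩
  have hα₀ : 0 ≤ α := hα ▸ Int.emod_nonneg _ hN.ne'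
  have hβ₀ : 0 ≤ β := hβ ▸ Int.emod_nonneg _ hN.ne'
  have hα₁ : α = 0 ↔ a = a' := by
    rw [← hα, sub_emod_of_mem ha (by omega) hc (by omega)]
    split_ifs <;> omega
  have hβ₁ : β = 0 ↔ b = b' := by
    rw [← hβ, Int.mul_emod_mul_of_pos _ _ he, sub_emod_of_mem hb hb' hd hd', mul_eq_zero,
      or_iff_right he.ne']
    split_ifs <;> omega
  rw [pairRHS]
  simp only [hat, hau, hbt, hbu, hα, hβ]
  have hα₂ (h : a ≠ a') : ∃ δ, (a < a' ∧ δ = 0 ∨ a' < a ∧ δ = 1) ∧ α = a' - a + e * r * δ := by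
    rw [sub_emod_of_mem ha (by omega) hc (by omega)] at hα
    split_ifs at hα with hlt
    · exact ⟨1, by omega, by rw [← hα]; ring⟩
    · exact ⟨0, by omega, by rw [← hα]; ring⟩
  have hβ₂ (h : b ≠ b') :
      ∃ ε, (b < b' ∧ ε = 0 ∨ b' < b ∧ ε = 1) ∧ β = e * (b' - b) + e * r * ε := by
    rw [mul_sub_emod_of_mem he hb hb' hd hd'] at hβ
    split_ifs at hβ with hlt
    · exact ⟨1, by omega, by rw [← hβ]; ring⟩
    · exact ⟨0, by omega, by rw [← hβ]; ring⟩
  have hw (x y : ℤ) : Finsupp.linearCombination K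
      (fun p : ℤ × ℤ => pairVec σ z a₀ b₀ e r R i j p.1 p.2) (pairTerm x y) =
        pairVec σ z a₀ b₀ e r R i j x y := by
    simp [pairTerm]
  by_cases h1 : a = a' <;> by_cases h2 : b = b'
  · rw [if_pos ⟨hα₁.2 h1, hβ₁.2 h2⟩, map_neg, hw, eq_neg_iff_add_eq_zero]
    subst h1 h2
    rw [ht, hu, pairVec_colourEnc ⟨ha, ha'⟩ ⟨hb, hb'⟩ ⟨hc, hc'⟩ ⟨hd, hd'⟩,
      pairVec_colourEnc ⟨ha, ha'⟩ ⟨hb, hb'⟩ ⟨hc, hc'⟩ ⟨hd, hd'⟩]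
    exact degVec_same hσ hij hR a b m n
  · subst h1
    obtain ⟨ε, hε, rfl⟩ := hβ₂ h2
    rw [if_neg (fun h => h2 (hβ₁.1 h.2)), if_neg (fun h => h2 (hβ₁.1 h)), if_pos (hα₁.2 rfl),
      map_add, map_neg, map_smul, map_smul, map_sub, hw,
      linearCombination_pairSum_zero (pairVec σ z a₀ b₀ e r R i j) hN hβ₀,
      linearCombination_pairSum_one (pairVec σ z a₀ b₀ e r R i j) hN,
      pairVec_first hσ hz hz0 hij hR ⟨ha, ha'⟩ ⟨hb, hb'⟩ ⟨hd, hd'⟩ hε ht hu htu]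
    congr 4
    ext m
    push_cast
    rw [show 2 * ((m : ℤ) + 1) - 1 = (2 * m + 1 : ℕ) by push_cast; ring, zpow_natCast]
  · subst h2
    obtain ⟨δ, hδ, rfl⟩ := hα₂ h1
    rw [if_neg (fun h => h1 (hα₁.1 h.1)), if_pos (hβ₁.2 rfl),
      map_add, map_neg, map_smul, map_smul, map_sub, hw,
      linearCombination_pairSum_zero (pairVec σ z a₀ b₀ e r R i j) hN hα₀,
      linearCombination_pairSum_one (pairVec σ z a₀ b₀ e r R i j) hN,
      pairVec_second hσ hz hz0 hij hR ⟨ha, ha'⟩ ⟨hc, hc'⟩ ⟨hb, hb'⟩ hδ ht hu htu]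
    congr 3
    · rw [zpow_neg, inv_pow]
      norm_cast
    · congr 1
      ext m
      rw [show -2 * (m : ℤ) = -(2 * m : ℕ) by push_cast; ring, zpow_neg, zpow_natCast, inv_pow]
    · congr 1
      ext m
      rw [show 1 - 2 * ((m + 1 : ℕ) : ℤ) = -(2 * m + 1 : ℕ) by push_cast; ring, zpow_neg,
        zpow_natCast, inv_pow]
  · obtain ⟨δ, hδ, hα'⟩ := hα₂ h1
    obtain ⟨ε, hε, hβ'⟩ := hβ₂ h2
    rw [if_neg (fun h => h1 (hα₁.1 h.1)), if_neg (fun h => h2 (hβ₁.1 h)),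
      if_neg (fun h => h1 (hα₁.1 h))]
    simp only [map_add, map_neg, map_smul, hw]
    rw [linearCombination_pairSum_zero (pairVec σ z a₀ b₀ e r R i j) hN hα₀,
      linearCombination_pairSum_zero (pairVec σ z a₀ b₀ e r R i j) hN hβ₀,
      linearCombination_pairSum_zero (pairVec σ z a₀ b₀ e r R i j) hN (add_nonneg hα₀ hβ₀),
      linearCombination_pairSum_one (pairVec σ z a₀ b₀ e r R i j) hN,
      pairVec_four hσ hz hz0 hij hR ⟨ha, ha'⟩ ⟨hc, hc'⟩ ⟨hb, hb'⟩ ⟨hd, hd'⟩ hδ hε hα' hβ'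
        (φ := fun m => (qK ^ (2 * (m : ℤ) + 1) + qK ^ (-2 * (m : ℤ) - 1)) / (qK + qK⁻¹))
        (ψ := fun m => (qK ^ (2 * (m : ℤ) + 2) - qK ^ (-2 * (m : ℤ) - 2)) / (qK + qK⁻¹))
        ?_ ?_ ?_ ?_ ht hu htu]
    · have hψ : (fun m : ℕ => (qK ^ (2 * ((m + 1 : ℕ) : ℤ)) - qK ^ (-2 * ((m + 1 : ℕ) : ℤ))) /
          (qK + qK⁻¹)) =
          fun m : ℕ => (qK ^ (2 * (m : ℤ) + 2) - qK ^ (-2 * (m : ℤ) - 2)) / (qK + qK⁻¹) := by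
        ext m
        rw [show 2 * ((m + 1 : ℕ) : ℤ) = 2 * (m : ℤ) + 2 by push_cast; ring,
          show -2 * ((m + 1 : ℕ) : ℤ) = -2 * (m : ℤ) - 2 by push_cast; ring]
      rw [hψ]
      rw [show qK⁻¹ - qK = -(qK - qK⁻¹) by ring]
      simp only [neg_smul]
      abel
    · simp [div_self hq1]
    · rw [div_eq_iff hq1]
      simp only [Nat.cast_zero, mul_zero, zero_add, zero_sub, zpow_neg]
      norm_cast
      field_simp
      ring
    · intro m
      rw [mul_div_assoc', ← add_div]
      congr 1
      simp only [Nat.cast_add, Nat.cast_one, mul_add, mul_one, sub_eq_add_neg, zpow_add₀ hq0]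
      generalize qK ^ (2 * (m : ℤ)) = A, qK ^ (-2 * (m : ℤ)) = B
      simp only [zpow_neg, zpow_ofNat]
      field_simp
      ring
    · intro m
      rw [mul_div_assoc', ← add_div]
      congr 1
      simp only [Nat.cast_add, Nat.cast_one, mul_add, mul_one, sub_eq_add_neg, zpow_add₀ hq0]
      generalize qK ^ (2 * (m : ℤ)) = A, qK ^ (-2 * (m : ℤ)) = B
      simp only [zpow_neg, zpow_ofNat]
      field_simp
      ring

end PairFormula

section WedgeVectors

open Equiv

variable {F : Type*} [Field F] [Algebra K F] {l : ℕ} {σ : Perm (Fin l) →* (F ≃ₐ[K] F)}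
  {z : Fin l → F} {e r : ℤ}

variable (z e r) in
/-- The vector attached to an `l`-tuple of integers: its colours give the position and its
degrees the monomial. -/
def wedgeVec (ts : Fin l → ℤ) : (Fin l → ℤ) → (Fin l → ℤ) → F :=
  Pi.single (fun n => bFun e r (ts n)) (Pi.single (fun n => aFun e (ts n))
    (∏ n, z n ^ mFun e r (ts n)))

lemma updPair_eq_setTwo {j j' : Fin l} (h : (j' : ℕ) = j + 1) (ts : Fin l → ℤ) (p : ℤ × ℤ) :
    updPair l ts j p = setTwo ts j j' p.1 p.2 := by
  have hne : j ≠ j' := by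
    rintro rfl
    omega
  ext n
  by_cases h1 : n = j
  · subst h1
    simp [updPair, setTwo, hne]
  · by_cases h2 : n = j'
    · subst h2
      simp [updPair, setTwo, h]
    · simp [updPair, setTwo, h1, h2, ← h, Fin.val_inj]

lemma apply_setTwo {A : Type*} (f : ℤ → ℤ) (g : A → ℤ) [DecidableEq A] (i j : A) (x y : ℤ) :
    (fun n => f (setTwo g i j x y n)) = setTwo (fun n => f (g n)) i j (f x) (f y) := by
  ext n
  simp only [setTwo, Function.update_apply]
  split_ifs <;> rfl

lemma heckeDiff_wedgeVec {i j : Fin l} (hij : i ≠ j) (ts : Fin l → ℤ) (x y : ℤ) :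
    heckeDiff σ z qK i j (wedgeVec z e r (setTwo ts i j x y)) =
      pairVec σ z (fun n => aFun e (ts n)) (fun n => bFun e r (ts n)) e r
        (∏ n ∈ {i, j}ᶜ, z n ^ mFun e r (ts n)) i j x y := by
  rw [pairVec, degVec]
  congr 1
  rw [wedgeVec, siteVec, apply_setTwo, apply_setTwo]
  simp only [LinearMap.comp_apply, LinearMap.single_apply]
  congr 2
  rw [← Finset.prod_mul_prod_compl {i, j}, Finset.prod_pair hij]
  simp only [setTwo_left hij, setTwo_right]
  congr 1
  refine Finset.prod_congr rfl fun n hn => ?_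
  simp only [Finset.mem_compl, Finset.mem_insert, Finset.mem_singleton, not_or] at hn
  simp [setTwo, hn.1, hn.2]

lemma swap_prod_compl (hσ : ∀ g i, σ g (z i) = z (g i)) (i j : Fin l) (m : Fin l → ℤ) :
    σ (swap i j) (∏ n ∈ {i, j}ᶜ, z n ^ m n) = ∏ n ∈ {i, j}ᶜ, z n ^ m n := by
  rw [map_prod]
  refine Finset.prod_congr rfl fun n hn => ?_
  simp only [Finset.mem_compl, Finset.mem_insert, Finset.mem_singleton, not_or] at hn
  rw [map_zpow₀, hσ, swap_apply_of_ne_of_ne hn.1 hn.2]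

lemma one_add_wedgeOp_relator (hσ : ∀ g i, σ g (z i) = z (g i)) (hz : Function.Injective z)
    (hz0 : ∀ i, z i ≠ 0) (he : 0 < e) (hr : 0 < r) {j j' : Fin l} (h : (j' : ℕ) = j + 1)
    (ts : Fin l → ℤ) (hts : ts j ≤ ts j') :
    (1 + wedgeOp σ z qK j j') (Finsupp.linearCombination K (wedgeVec z e r)
      (Finsupp.single ts 1 - (pairRHS e r (ts j) (ts j')).sum fun p c =>
        Finsupp.single (updPair l ts j p) c)) = 0 := by
  have hne : j ≠ j' := by
    rintro rfl
    omega
  have hts' : setTwo ts j j' (ts j) (ts j') = ts := by simp [setTwo]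
  refine one_add_wedgeOp_apply_of_heckeDiff qK_ne_zero ?_
  rw [map_sub, map_sub, Finsupp.linearCombination_single, one_smul, sub_eq_zero]
  conv_lhs => rw [← hts', heckeDiff_wedgeVec hne]
  rw [pairVec_eq_linearCombination_pairRHS hσ hz hz0 hne (swap_prod_compl hσ j j' _) he hr hts,
    Finsupp.linearCombination_apply, Finsupp.sum, Finsupp.sum, map_sum, map_sum]
  refine Finset.sum_congr rfl fun p _ => ?_
  rw [Finsupp.linearCombination_single, map_smul, updPair_eq_setTwo h, heckeDiff_wedgeVec hne]

variable (σ z) in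
/-- The operator `wedgeOp` at the adjacent sites `i, i + 1`, or zero when there are no such
sites. -/
def siteOp (i : ℕ) : Module.End K ((Fin l → ℤ) → (Fin l → ℤ) → F) :=
  if h : i + 1 < l then wedgeOp σ z qK ⟨i, by omega⟩ ⟨i + 1, h⟩ else 0

lemma siteOp_commute (hσ : ∀ g i, σ g (z i) = z (g i)) (i j : ℕ) (h : i + 2 ≤ j) :
    Commute (siteOp σ z i) (siteOp σ z j) := by
  unfold siteOp
  split_ifs with h1 h2
  · apply wedgeOp_commute hσ <;> simp only [ne_eq, Fin.mk.injEq] <;> omega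
  · exact Commute.zero_right _
  · exact Commute.zero_left _
  · exact Commute.zero_left _

lemma siteOp_braid (hσ : ∀ g i, σ g (z i) = z (g i)) (hz : Function.Injective z) (i : ℕ) :
    siteOp σ z i * siteOp σ z (i + 1) * siteOp σ z i =
      siteOp σ z (i + 1) * siteOp σ z i * siteOp σ z (i + 1) := by
  by_cases h : i + 1 + 1 < l
  · rw [siteOp, siteOp, dif_pos h, dif_pos (by omega)]
    apply wedgeOp_braid hσ hz qK_ne_zero <;> simp only [ne_eq, Fin.mk.injEq] <;> omega
  · rw [show siteOp σ z (i + 1) = 0 from dif_neg h, mul_zero, zero_mul, zero_mul]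

lemma symmetrizer_relator (hσ : ∀ g i, σ g (z i) = z (g i)) (hz : Function.Injective z)
    (hz0 : ∀ i, z i ≠ 0) (he : 0 < e) (hr : 0 < r) {x : FW l} (hx : x ∈ relSet e r l) :
    symmetrizer (siteOp σ z) l (Finsupp.linearCombination K (wedgeVec z e r) x) = 0 := by
  obtain ⟨ts, j, j', h, hts, rfl⟩ := hx
  obtain ⟨Y, hY⟩ := symmetrizer_right_dvd (siteOp_commute hσ) (siteOp_braid hσ hz)
    (show (j : ℕ) + 2 ≤ l by omega)
  have hS : siteOp σ z (j : ℕ) = wedgeOp σ z qK j j' := by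
    have h1 : (j : ℕ) + 1 < l := by omega
    rw [siteOp, dif_pos h1]
    congr 1
    ext
    exact h.symm
  rw [hY, hS, Module.End.mul_apply, one_add_wedgeOp_relator hσ hz hz0 he hr h ts hts, map_zero]

lemma linearIndependent_wedge_of_symmetrizer (hσ : ∀ g i, σ g (z i) = z (g i))
    (hz : Function.Injective z) (hz0 : ∀ i, z i ≠ 0) (he : 0 < e) (hr : 0 < r)
    (h : LinearIndependent K (fun ts : {f : Fin l → ℤ // StrictAnti f} =>
      symmetrizer (siteOp σ z) l (wedgeVec z e r ts.1))) :
    LinearIndependent K (fun ts : {f : Fin l → ℤ // StrictAnti f} => wedge e r l ts.1) := by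
  have hle : Submodule.span K (relSet e r l) ≤ LinearMap.ker
      (symmetrizer (siteOp σ z) l ∘ₗ Finsupp.linearCombination K (wedgeVec z e r)) :=
    Submodule.span_le.2 fun x hx => symmetrizer_relator hσ hz hz0 he hr hx
  refine LinearIndependent.of_comp (Submodule.liftQ _ _ hle) ?_
  convert h using 2 with ts
  · rw [Function.comp_apply, wedge, Submodule.liftQ_apply, LinearMap.comp_apply,
      Finsupp.linearCombination_single, one_smul]
  · rfl

end WedgeVectors

section Alternation

open Equiv

lemma mul_cosetSum_of_fixed {R : Type*} [Ring R] {A : R} {S : ℕ → R} {l : ℕ}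
    (h : ∀ i, i + 1 < l → A * S i = A) {k : ℕ} (hk : k < l) :
    A * cosetSum S k = (k + 1) • A := by
  induction k with
  | zero => simp [cosetSum_zero]
  | succ k ih =>
    rw [cosetSum_succ, mul_add, mul_one, ← mul_assoc, ih (by omega), smul_mul_assoc, h k hk,
      succ_nsmul' A (k + 1)]

lemma mul_symmetrizer_of_fixed {R : Type*} [Ring R] {A : R} {S : ℕ → R} {l : ℕ}
    (h : ∀ i, i + 1 < l → A * S i = A) {n : ℕ} (hn : n ≤ l) :
    A * symmetrizer S n = n.factorial • A := by
  induction n with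
  | zero => simp [symmetrizer_zero]
  | succ n ih =>
    rw [symmetrizer_succ, ← mul_assoc, mul_cosetSum_of_fixed h hn, smul_mul_assoc, ih (by omega),
      smul_smul, Nat.factorial_succ]

variable {k E : Type*} [Field k] [Field E] [Algebra k E] {l : ℕ}
  (τ : Perm (Fin l) →* (E ≃ₐ[k] E))
  {y : Fin l → E} {e r : ℤ}

/-- The simultaneous permutation of the variables and of the two tuples of colours. -/
def permAct : Perm (Fin l) →* Module.End k ((Fin l → ℤ) → (Fin l → ℤ) → E) where
  toFun w :=
    { toFun g b a := τ w (g (b ∘ w) (a ∘ w))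
      map_add' f g := by ext; simp
      map_smul' c f := by ext; simp }
  map_one' := by ext; simp
  map_mul' w w' := by ext; simp [Function.comp_assoc]

lemma permAct_apply (w : Perm (Fin l)) (g : (Fin l → ℤ) → (Fin l → ℤ) → E)
    (b a : Fin l → ℤ) : permAct τ w g b a = τ w (g (b ∘ w) (a ∘ w)) := rfl

/-- The antisymmetrization operator. -/
def alternation : Module.End k ((Fin l → ℤ) → (Fin l → ℤ) → E) :=
  ∑ w : Perm (Fin l), (Perm.sign w : ℤ) • permAct τ w

/-- The operators `siteOp` specialized at `q = 1`. -/
def signedSwap (i : ℕ) : Module.End k ((Fin l → ℤ) → (Fin l → ℤ) → E) :=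
  if h : i + 1 < l then -permAct τ (swap ⟨i, by omega⟩ ⟨i + 1, h⟩) else 0

lemma alternation_mul_signedSwap {i : ℕ} (h : i + 1 < l) :
    alternation τ * signedSwap τ i = alternation τ := by
  have hne : (⟨i, by omega⟩ : Fin l) ≠ ⟨i + 1, h⟩ := by simp
  rw [signedSwap, dif_pos h, alternation, Finset.sum_mul]
  refine Fintype.sum_equiv (Equiv.mulRight (swap ⟨i, by omega⟩ ⟨i + 1, h⟩)) _ _ fun w => ?_
  rw [Equiv.coe_mulRight, Perm.sign_mul, Perm.sign_swap hne, map_mul, smul_mul_assoc,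
    mul_neg_one, Units.val_neg, neg_smul, ← smul_neg]
  exact congrArg _ (LinearMap.comp_neg _ _)

lemma wedgeVec_apply (ts b a : Fin l → ℤ) :
    wedgeVec y e r ts b a = if b = (fun n => bFun e r (ts n)) ∧ a = (fun n => aFun e (ts n))
      then ∏ n, y n ^ mFun e r (ts n) else 0 := by
  rw [wedgeVec, Pi.single_apply, ite_and]
  split_ifs <;> simp_all

lemma permAct_wedgeVec (hτ : ∀ g i, τ g (y i) = y (g i)) (w : Perm (Fin l)) (ts : Fin l → ℤ) :
    permAct τ w (wedgeVec y e r ts) = wedgeVec y e r (ts ∘ w.symm) := by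
  ext b a
  have key (f : ℤ → ℤ) (c : Fin l → ℤ) :
      (c ∘ w = fun n => f (ts n)) ↔ c = fun n => f ((ts ∘ w.symm) n) := by
    rw [show (fun n => f ((ts ∘ w.symm) n)) = (fun n => f (ts n)) ∘ w.symm from rfl,
      Equiv.eq_comp_symm]
  simp only [permAct_apply, wedgeVec_apply, key, apply_ite (τ w), map_zero]
  congr 1
  simp only [map_prod, map_zpow₀, hτ]
  exact Fintype.prod_equiv w _ _ fun n => by simp

lemma linearIndependent_wedgeVec (he : 0 < e) (hr : 0 < r)
    (hy : LinearIndependent k fun m : Fin l → ℤ => ∏ n, y n ^ m n) :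
    LinearIndependent k fun ts : Fin l → ℤ => wedgeVec y e r ts := by
  rw [linearIndependent_iff']
  intro s c hc t₀ ht₀
  classical
  have h0 := congrFun (congrFun hc fun n => bFun e r (t₀ n)) fun n => aFun e (t₀ n)
  simp only [Finset.sum_apply, Pi.smul_apply, Pi.zero_apply] at h0
  set s' := s.filter fun ts => (fun n => bFun e r (t₀ n)) = (fun n => bFun e r (ts n)) ∧
    (fun n => aFun e (t₀ n)) = (fun n => aFun e (ts n)) with hs'
  have hinj : Set.InjOn (fun (ts : Fin l → ℤ) n => mFun e r (ts n)) s' := by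
    intro t ht t' ht' h
    simp only [hs', Finset.coe_filter, Set.mem_ofPred_eq] at ht ht'
    ext n
    rw [← colourEnc_aFun_bFun_mFun he hr (t n), ← colourEnc_aFun_bFun_mFun he hr (t' n),
      ← congrFun ht.2.1 n, ← congrFun ht.2.2 n, ← congrFun ht'.2.1 n, ← congrFun ht'.2.2 n,
      show mFun e r (t n) = mFun e r (t' n) from congrFun h n]
  have hli : LinearIndepOn k (fun ts : Fin l → ℤ => ∏ n, y n ^ mFun e r (ts n)) (s' : Set _) :=
    hy.comp _ hinj.injective
  rw [linearIndepOn_iff'] at hli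
  refine hli s' c subset_rfl ?_ t₀ (by simp [hs', ht₀])
  rw [← h0, hs', Finset.sum_filter]
  refine Finset.sum_congr rfl fun t _ => ?_
  rw [wedgeVec_apply, smul_ite, smul_zero]

end Alternation

section Specialization

open Polynomial

lemma linearIndependent_of_eval_one {k K' W ι : Type*} [Field k] [Field K'] [Algebra k[X] K']
    [IsFractionRing k[X] K'] [AddCommGroup W] [Module K' W] {w : ι → W}
    (h : ∀ (s : Finset ι) (P : ι → k[X]), ∑ i ∈ s, algebraMap k[X] K' (P i) • w i = 0 →
      ∀ i ∈ s, (P i).eval 1 = 0) : LinearIndependent K' w := by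
  have hdvd (n : ℕ) (s : Finset ι) (P : ι → k[X])
      (hP : ∑ i ∈ s, algebraMap k[X] K' (P i) • w i = 0) : ∀ i ∈ s, (X - C 1) ^ n ∣ P i := by
    induction n generalizing P with
    | zero => simp
    | succ n ih =>
      have h1 (i) (hi : i ∈ s) : X - C 1 ∣ P i := dvd_iff_isRoot.2 (h s P hP i hi)
      have hX : algebraMap k[X] K' (X - C 1) ≠ 0 := by
        simpa only [ne_eq, FaithfulSMul.algebraMap_eq_zero_iff] using X_sub_C_ne_zero (1 : k)
      choose! Q hQ using h1
      have h2 : ∑ i ∈ s, algebraMap k[X] K' (Q i) • w i = 0 := by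
        refine (smul_eq_zero_iff_right hX).1 ?_
        rw [← hP, Finset.smul_sum]
        exact Finset.sum_congr rfl fun i hi => by rw [hQ i hi, map_mul, mul_smul]
      intro i hi
      rw [hQ i hi, pow_succ']
      exact mul_dvd_mul_left _ (ih Q h2 i hi)
  have hzero (s : Finset ι) (P : ι → k[X])
      (hP : ∑ i ∈ s, algebraMap k[X] K' (P i) • w i = 0) (i : ι) (hi : i ∈ s) : P i = 0 := by
    refine eq_zero_of_dvd_of_natDegree_lt (hdvd ((P i).natDegree + 1) s P hP i hi) ?_
    rw [natDegree_pow, natDegree_X_sub_C]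
    omega
  rw [linearIndependent_iff']
  intro s g hg i hi
  obtain ⟨b, hb⟩ := IsLocalization.exist_integer_multiples (nonZeroDivisors k[X]) s g
  have hb0 : algebraMap k[X] K' b ≠ 0 := by
    simpa only [ne_eq, FaithfulSMul.algebraMap_eq_zero_iff] using nonZeroDivisors.coe_ne_zero b
  choose! P hP using hb
  have h1 : P i = 0 := by
    refine hzero s P ?_ i hi
    rw [← smul_zero (algebraMap k[X] K' b), ← hg, Finset.smul_sum]
    exact Finset.sum_congr rfl fun j hj => by
      rw [hP j hj, Algebra.smul_def, mul_smul]
  have h2 := hP i hi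
  rw [h1, map_zero, Algebra.smul_def] at h2
  exact (mul_eq_zero.1 h2.symm).resolve_left hb0

end Specialization

section Reduction

open Equiv

variable {k E : Type*} [Field k] [Field E] [Algebra k E] {l : ℕ} {τ : Perm (Fin l) →* (E ≃ₐ[k] E)}
  {y : Fin l → E} {e r : ℤ}

lemma linearIndependent_symmetrizer_signedSwap [CharZero k] (hτ : ∀ g i, τ g (y i) = y (g i))
    (he : 0 < e) (hr : 0 < r)
    (hy : LinearIndependent k fun m : Fin l → ℤ => ∏ n, y n ^ m n) :
    LinearIndependent k fun ts : {f : Fin l → ℤ // StrictAnti f} =>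
      symmetrizer (signedSwap τ) l (wedgeVec y e r ts.1) := by
  refine LinearIndependent.of_comp (alternation τ) ?_
  have h1 (ts : Fin l → ℤ) : alternation τ (symmetrizer (signedSwap τ) l (wedgeVec y e r ts)) =
      Finsupp.linearCombination k (fun ts : Fin l → ℤ => wedgeVec y e r ts)
        ((l.factorial : k) • ∑ w : Perm (Fin l),
          Finsupp.single (ts ∘ w.symm) (((Perm.sign w : ℤ) : k))) := by
    rw [← Module.End.mul_apply,
      mul_symmetrizer_of_fixed (fun i hi => alternation_mul_signedSwap τ hi) le_rfl,
      map_smul, map_sum, ← Nat.cast_smul_eq_nsmul k, LinearMap.smul_apply, alternation,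
      LinearMap.sum_apply]
    congr 1
    refine Finset.sum_congr rfl fun w _ => ?_
    rw [Finsupp.linearCombination_single, LinearMap.smul_apply, permAct_wedgeVec τ hτ,
      Int.cast_smul_eq_zsmul]
  have h2 := linearIndependent_wedgeVec he hr hy
  rw [show _ ∘ _ = _ from funext fun ts : {f : Fin l → ℤ // StrictAnti f} => h1 ts.1,
    linearIndependent_iff']
  intro s c hc t ht
  simp only [← map_smul, ← map_sum] at hc
  have h3 := DFunLike.congr_fun ((linearIndependent_iff.1 h2) _ hc) t.1
  have key (x : {f : Fin l → ℤ // StrictAnti f}) (w : Perm (Fin l)) :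
      x.1 ∘ w.symm = t.1 ↔ x = t ∧ w = 1 := by
    refine ⟨fun h => ?_, by rintro ⟨rfl, rfl⟩; rfl⟩
    rw [Equiv.comp_symm_eq] at h
    have hw : StrictMono w := fun i j hij => by
      have h4 := x.2 hij
      rw [h] at h4
      exact t.2.lt_iff_gt.1 h4
    have hw1 : w = 1 := Equiv.ext fun i =>
      congrFun ((hw.range_inj strictMono_id).1 (by simp)) i
    exact ⟨Subtype.ext (by rw [h, hw1]; rfl), hw1⟩
  have h4 (x : {f : Fin l → ℤ // StrictAnti f}) :
      (∑ w : Perm (Fin l), Finsupp.single (x.1 ∘ w.symm) (((Perm.sign w : ℤ) : k))) t.1 =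
        if x = t then 1 else 0 := by
    rw [Finsupp.finsetSum_apply]
    simp only [Finsupp.single_apply, key]
    by_cases hx : x = t <;> simp [hx]
  simp only [Finsupp.finsetSum_apply s, Finsupp.smul_apply, h4] at h3
  simpa [ht, Nat.factorial_ne_zero] using h3

variable {F : Type*} [Field F] [Algebra K F] {σ : Perm (Fin l) →* (F ≃ₐ[K] F)} {z : Fin l → F}
  {ρ : Subring (F × E)}

variable (ρ) in
/-- The second family reduces to the first one, entry by entry. -/
def FamilyRed (g : (Fin l → ℤ) → (Fin l → ℤ) → F) (h : (Fin l → ℤ) → (Fin l → ℤ) → E) : Prop :=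
  ∀ b a, (g b a, h b a) ∈ ρ

lemma hecke_red {p : K} (hp : (algebraMap K F p, (1 : E)) ∈ ρ)
    (hp' : (algebraMap K F p⁻¹, (1 : E)) ∈ ρ) {f : (Fin l → ℤ) → F} {h : (Fin l → ℤ) → E}
    (hf : ∀ a, (f a, h a) ∈ ρ) (i j : Fin l) (a : Fin l → ℤ) :
    (hecke F p i j f a, h (a ∘ swap i j)) ∈ ρ := by
  rw [hecke_apply]
  split_ifs with h1 h2
  · have h3 : a ∘ swap i j = a := by
      ext n
      rw [Function.comp_apply, swap_apply_def]
      split_ifs with h4 h5 <;> simp_all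
    rw [h3, Algebra.smul_def]
    simpa using ρ.mul_mem hp (hf a)
  · rw [Algebra.smul_def, map_sub]
    simpa using ρ.add_mem (hf (a ∘ swap i j)) (ρ.mul_mem (ρ.sub_mem hp hp') (hf a))
  · simpa using hf (a ∘ swap i j)

lemma siteOp_red (hq : (algebraMap K F qK, (1 : E)) ∈ ρ)
    (hq' : (algebraMap K F qK⁻¹, (1 : E)) ∈ ρ)
    (hσ : ∀ g x x', (x, x') ∈ ρ → (σ g x, τ g x') ∈ ρ)
    (hz : ∀ i j, i ≠ j → (z i / (z i - z j), y i / (y i - y j)) ∈ ρ)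
    {g : (Fin l → ℤ) → (Fin l → ℤ) → F} {h : (Fin l → ℤ) → (Fin l → ℤ) → E}
    (hg : FamilyRed ρ g h) (i : ℕ) : FamilyRed ρ (siteOp σ z i g) (signedSwap τ i h) := by
  intro b a
  rw [siteOp, signedSwap]
  split_ifs with hi
  · generalize hm : (⟨i, by omega⟩ : Fin l) = m
    generalize hn : (⟨i + 1, hi⟩ : Fin l) = n
    have hmn : m ≠ n := by
      rw [← hm, ← hn, ne_eq, Fin.mk.injEq]
      omega
    have h1 (a) : (hecke _ qK⁻¹ m n g b a, h (b ∘ swap m n) a) ∈ ρ := by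
      have h2 : hecke _ qK⁻¹ m n g b a = hecke F qK⁻¹ m n (fun b => g b a) b := by
        simp only [hecke_apply]
        split_ifs <;> rfl
      rw [h2]
      exact hecke_red (h := fun b => h b a) hq' (by rwa [inv_inv]) (fun b => hg b a) m n b
    set f := hecke _ qK⁻¹ m n g b with hf
    have h3 : wedgeOp σ z qK m n g b a = -(hecke F qK m n (fun a => σ (swap m n) (f a)) a +
        (qK - qK⁻¹) • (z m / (z m - z n) * (f a - σ (swap m n) (f a)))) := rfl
    have h4 := hecke_red (h := fun a => τ (swap m n) (h (b ∘ swap m n) a)) hq hq'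
      (fun a => hσ (swap m n) _ _ (h1 a)) m n a
    have h5 := ρ.mul_mem (ρ.sub_mem hq hq')
      (ρ.mul_mem (hz m n hmn) (ρ.sub_mem (h1 a) (hσ (swap m n) _ _ (h1 a))))
    rw [h3, Algebra.smul_def, map_sub]
    have h6 := ρ.neg_mem (ρ.add_mem h4 h5)
    simp only [Prod.mk_sub_mk, Prod.mk_mul_mk, Prod.mk_add_mk, Prod.neg_mk, sub_self, zero_mul,
      add_zero] at h6
    exact h6
  · exact ρ.zero_mem

lemma cosetSum_red {S : ℕ → Module.End K ((Fin l → ℤ) → (Fin l → ℤ) → F)}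
    {T : ℕ → Module.End k ((Fin l → ℤ) → (Fin l → ℤ) → E)}
    (hS : ∀ i g h, FamilyRed ρ g h → FamilyRed ρ (S i g) (T i h)) (n : ℕ)
    {g : (Fin l → ℤ) → (Fin l → ℤ) → F} {h : (Fin l → ℤ) → (Fin l → ℤ) → E}
    (hg : FamilyRed ρ g h) : FamilyRed ρ (cosetSum S n g) (cosetSum T n h) := by
  induction n generalizing g h with
  | zero => exact hg
  | succ n ih => exact fun b a => ρ.add_mem (hg b a) (ih (hS n g h hg) b a)

lemma symmetrizer_red {S : ℕ → Module.End K ((Fin l → ℤ) → (Fin l → ℤ) → F)}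
    {T : ℕ → Module.End k ((Fin l → ℤ) → (Fin l → ℤ) → E)}
    (hS : ∀ i g h, FamilyRed ρ g h → FamilyRed ρ (S i g) (T i h)) (n : ℕ)
    {g : (Fin l → ℤ) → (Fin l → ℤ) → F} {h : (Fin l → ℤ) → (Fin l → ℤ) → E}
    (hg : FamilyRed ρ g h) : FamilyRed ρ (symmetrizer S n g) (symmetrizer T n h) := by
  induction n with
  | zero => exact hg
  | succ n ih => exact cosetSum_red hS n ih

omit [Algebra K F] in
lemma wedgeVec_red (hz : ∀ i (m : ℤ), (z i ^ m, y i ^ m) ∈ ρ) (ts : Fin l → ℤ) :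
    FamilyRed ρ (wedgeVec z e r ts) (wedgeVec y e r ts) := by
  intro b a
  rw [wedgeVec_apply, wedgeVec_apply]
  split_ifs
  · have h1 := ρ.prod_mem fun n (_ : n ∈ Finset.univ) => hz n (mFun e r (ts n))
    rwa [← prod_mk_prod] at h1
  · exact ρ.zero_mem

open Polynomial in
lemma linearIndependent_symmetrizer_siteOp [CharZero k] [Algebra k[X] K] [IsFractionRing k[X] K]
    (he : 0 < e) (hr : 0 < r)
    (hρ : ∀ x', ((0 : F), x') ∈ ρ → x' = 0)
    (hP : ∀ P : k[X], (algebraMap K F (algebraMap k[X] K P), algebraMap k E (P.eval 1)) ∈ ρ)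
    (hq : (algebraMap K F qK, (1 : E)) ∈ ρ) (hq' : (algebraMap K F qK⁻¹, (1 : E)) ∈ ρ)
    (hσ : ∀ g x x', (x, x') ∈ ρ → (σ g x, τ g x') ∈ ρ)
    (hz : ∀ i j, i ≠ j → (z i / (z i - z j), y i / (y i - y j)) ∈ ρ)
    (hz' : ∀ i (m : ℤ), (z i ^ m, y i ^ m) ∈ ρ) (hτ : ∀ g i, τ g (y i) = y (g i))
    (hy : LinearIndependent k fun m : Fin l → ℤ => ∏ n, y n ^ m n) :
    LinearIndependent K fun ts : {f : Fin l → ℤ // StrictAnti f} =>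
      symmetrizer (siteOp σ z) l (wedgeVec z e r ts.1) := by
  refine linearIndependent_of_eval_one (k := k) fun s P h0 => ?_
  refine linearIndependent_iff'.1
    (linearIndependent_symmetrizer_signedSwap (τ := τ) hτ he hr hy) s _ ?_
  have hred (ts : Fin l → ℤ) : FamilyRed ρ (symmetrizer (siteOp σ z) l (wedgeVec z e r ts))
      (symmetrizer (signedSwap τ) l (wedgeVec y e r ts)) :=
    symmetrizer_red (fun i g h hg => siteOp_red hq hq' hσ hz hg i) l (wedgeVec_red hz' ts)
  ext b a
  refine hρ _ ?_
  have h1 := congrFun (congrFun h0 b) a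
  simp only [Finset.sum_apply, Pi.smul_apply, Pi.zero_apply] at h1 ⊢
  simp only [Algebra.smul_def] at h1 ⊢
  rw [← h1]
  have h2 := ρ.sum_mem fun t (_ : t ∈ s) => ρ.mul_mem (hP (P t)) (hred t.1 b a)
  simp only [Prod.mk_mul_mk, ← prod_mk_sum] at h2
  exact h2

end Reduction

section SpecializationRing

variable {R F E : Type*} [CommRing R] [Field F] [Field E]

/-- The pairs of fractions `(φ p / φ d, ψ p / ψ d)` with `ψ d ≠ 0`. -/
def specRing (φ : R →+* F) (ψ : R →+* E) : Subring (F × E) where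
  carrier := {x | ∃ p d, ψ d ≠ 0 ∧ x.1 * φ d = φ p ∧ x.2 * ψ d = ψ p}
  mul_mem' := by
    rintro ⟨x, x'⟩ ⟨y, y'⟩ ⟨p, d, hd, h1, h2⟩ ⟨p', d', hd', h1', h2'⟩
    refine ⟨p * p', d * d', by simpa using ⟨hd, hd'⟩, ?_, ?_⟩
    · rw [map_mul, map_mul, ← h1, ← h1', Prod.mk_mul_mk]
      ring
    · rw [map_mul, map_mul, ← h2, ← h2', Prod.mk_mul_mk]
      ring
  one_mem' := ⟨1, 1, by simp, by simp, by simp⟩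
  add_mem' := by
    rintro ⟨x, x'⟩ ⟨y, y'⟩ ⟨p, d, hd, h1, h2⟩ ⟨p', d', hd', h1', h2'⟩
    refine ⟨p * d' + p' * d, d * d', by simpa using ⟨hd, hd'⟩, ?_, ?_⟩
    · rw [map_mul, map_add, map_mul, map_mul, ← h1, ← h1', Prod.mk_add_mk]
      ring
    · rw [map_mul, map_add, map_mul, map_mul, ← h2, ← h2', Prod.mk_add_mk]
      ring
  zero_mem' := ⟨0, 1, by simp, by simp, by simp⟩
  neg_mem' := by
    rintro ⟨x, x'⟩ ⟨p, d, hd, h1, h2⟩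
    exact ⟨-p, d, hd, by simpa using h1, by simpa using h2⟩

variable {φ : R →+* F} {ψ : R →+* E}

lemma map_mem_specRing (p : R) : (φ p, ψ p) ∈ specRing φ ψ := ⟨p, 1, by simp, by simp, by simp⟩

lemma eq_zero_of_mem_specRing (hφ : Function.Injective φ) {y : E}
    (h : (0, y) ∈ specRing φ ψ) : y = 0 := by
  obtain ⟨p, d, hd, h1, h2⟩ := h
  have hp : p = 0 := by
    rw [zero_mul] at h1
    exact (map_eq_zero_iff φ hφ).1 h1.symm
  rw [hp, map_zero] at h2
  exact (mul_eq_zero.1 h2).resolve_right hd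

lemma inv_mem_specRing (hφ : Function.Injective φ) {x : F} {y : E}
    (h : (x, y) ∈ specRing φ ψ) (hy : y ≠ 0) : (x⁻¹, y⁻¹) ∈ specRing φ ψ := by
  have hx : x ≠ 0 := by
    rintro rfl
    exact hy (eq_zero_of_mem_specRing hφ h)
  obtain ⟨p, d, hd, h1, h2⟩ := h
  refine ⟨d, p, ?_, ?_, ?_⟩
  · rw [← h2]
    exact mul_ne_zero hy hd
  · rw [← h1]
    exact inv_mul_cancel_left₀ hx _
  · rw [← h2]
    exact inv_mul_cancel_left₀ hy _

lemma zpow_mem_specRing (hφ : Function.Injective φ) {x : F} {y : E}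
    (h : (x, y) ∈ specRing φ ψ) (hy : y ≠ 0) (m : ℤ) : (x ^ m, y ^ m) ∈ specRing φ ψ := by
  obtain ⟨n, rfl | rfl⟩ := m.eq_nat_or_neg
  · simpa using (specRing φ ψ).pow_mem h n
  · simpa using (specRing φ ψ).pow_mem (inv_mem_specRing hφ h hy) n

lemma apply_mem_specRing {f : F →+* F} {g : E →+* E} (h : R →+* R)
    (hf : ∀ p, f (φ p) = φ (h p)) (hg : ∀ p, g (ψ p) = ψ (h p)) {x : F} {y : E}
    (hxy : (x, y) ∈ specRing φ ψ) : (f x, g y) ∈ specRing φ ψ := by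
  obtain ⟨p, d, hd, h1, h2⟩ := hxy
  refine ⟨h p, h d, ?_, ?_, ?_⟩
  · rw [← hg]
    simpa using hd
  · rw [← hf, ← hf, ← map_mul, h1]
  · rw [← hg, ← hg, ← map_mul, h2]

end SpecializationRing

section RationalFunctions

open Equiv

variable (k L : Type*) [Field k] [Field L] (l : ℕ) [Algebra (MvPolynomial (Fin l) k) L]
  [IsFractionRing (MvPolynomial (Fin l) k) L] [Algebra k L]
  [IsScalarTower k (MvPolynomial (Fin l) k) L]

/-- The permutations of the variables of a field of rational functions. -/
def permVars : Perm (Fin l) →* (L ≃ₐ[k] L) :=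
  (IsFractionRing.fieldEquivOfAlgEquivHom k L).comp
    { toFun g := MvPolynomial.renameEquiv k g
      map_one' := by
        ext i
        simp
      map_mul' g h := by
        ext i
        simp }

variable {k L l}

lemma permVars_algebraMap (g : Perm (Fin l)) (p : MvPolynomial (Fin l) k) :
    permVars k L l g (algebraMap _ _ p) = algebraMap _ _ (MvPolynomial.rename g p) :=
  IsFractionRing.fieldEquivOfAlgEquiv_algebraMap _ _ _ _ p

variable (k L) in
/-- The `i`-th variable of the field of rational functions. -/
def funVar (i : Fin l) : L := algebraMap (MvPolynomial (Fin l) k) _ (MvPolynomial.X i)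

lemma permVars_funVar (g : Perm (Fin l)) (i : Fin l) :
    permVars k L l g (funVar k L i) = funVar k L (g i) := by
  rw [funVar, permVars_algebraMap, MvPolynomial.rename_X, funVar]

omit [Algebra k L] [IsScalarTower k (MvPolynomial (Fin l) k) L] in
lemma funVar_injective : Function.Injective (funVar k L : Fin l → L) :=
  (FaithfulSMul.algebraMap_injective _ _).comp (MvPolynomial.X_injective)

omit [Algebra k L] [IsScalarTower k (MvPolynomial (Fin l) k) L] in
lemma funVar_ne_zero (i : Fin l) : funVar k L i ≠ 0 := by
  rw [funVar, ne_eq, FaithfulSMul.algebraMap_eq_zero_iff]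
  exact MvPolynomial.X_ne_zero i

lemma linearIndependent_laurent_monomials :
    LinearIndependent k fun m : Fin l → ℤ => ∏ n, funVar k L n ^ m n := by
  have h0 : LinearIndependent k fun m : Fin l →₀ ℕ =>
      algebraMap (MvPolynomial (Fin l) k) L (MvPolynomial.monomial m 1) := by
    have h1 := (MvPolynomial.basisMonomials (Fin l) k).linearIndependent.map'
      (IsScalarTower.toAlgHom k (MvPolynomial (Fin l) k) L).toLinearMap
      (LinearMap.ker_eq_bot.2 (FaithfulSMul.algebraMap_injective _ _))
    simpa [Function.comp_def] using h1
  rw [linearIndependent_iff']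
  intro s c hc
  obtain ⟨N, hN⟩ : ∃ N : ℕ, ∀ m ∈ s, ∀ n, 0 ≤ m n + N := by
    refine ⟨∑ m ∈ s, ∑ n, (m n).natAbs, fun m hm n => ?_⟩
    have h1 := Finset.single_le_sum (f := fun m : Fin l → ℤ => ∑ n, (m n).natAbs)
      (fun _ _ => Nat.zero_le _) hm
    have h2 := Finset.single_le_sum (f := fun n => (m n).natAbs)
      (fun _ _ => Nat.zero_le _) (Finset.mem_univ n)
    have h3 := h2.trans h1
    omega
  have hinj : Set.InjOn (fun m : Fin l → ℤ => Finsupp.equivFunOnFinite.symm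
      fun n => (m n + N).toNat) s := by
    intro m hm m' hm' h
    ext n
    have h1 := DFunLike.congr_fun h n
    change (m n + N).toNat = (m' n + N).toNat at h1
    have h2 := hN m hm n
    have h3 := hN m' hm' n
    omega
  have h2 : LinearIndepOn k (fun m : Fin l → ℤ => algebraMap (MvPolynomial (Fin l) k) L
      (MvPolynomial.monomial (Finsupp.equivFunOnFinite.symm fun n => (m n + N).toNat) 1))
      (s : Set (Fin l → ℤ)) := h0.comp _ hinj.injective
  refine linearIndepOn_iff'.1 h2 s c subset_rfl ?_
  rw [← zero_mul (∏ n : Fin l, funVar k L n ^ (N : ℤ)), ← hc, Finset.sum_mul]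
  refine Finset.sum_congr rfl fun m hm => ?_
  rw [smul_mul_assoc, ← Finset.prod_mul_distrib, MvPolynomial.monomial_eq]
  congr 1
  rw [Finsupp.prod_fintype _ _ (by simp), map_mul, MvPolynomial.C_1, map_one, one_mul, map_prod]
  refine Finset.prod_congr rfl fun n _ => ?_
  rw [map_pow, ← zpow_add₀ (funVar_ne_zero (l := l) n), ← zpow_natCast,
    Finsupp.equivFunOnFinite_symm_apply_apply, Int.toNat_of_nonneg (hN m hm n)]
  rfl

end RationalFunctions

section Independence

open Polynomial in
lemma linearIndependent_wedge_of_fields {k F E : Type*} [Field k] [CharZero k] [Algebra k[X] K]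
    [IsFractionRing k[X] K] (hqX : algebraMap k[X] K X = qK) [Field F] [Field E] {l : ℕ}
    [Algebra (MvPolynomial (Fin l) K) F] [IsFractionRing (MvPolynomial (Fin l) K) F]
    [Algebra K F] [IsScalarTower K (MvPolynomial (Fin l) K) F]
    [Algebra (MvPolynomial (Fin l) k) E] [IsFractionRing (MvPolynomial (Fin l) k) E]
    [Algebra k E] [IsScalarTower k (MvPolynomial (Fin l) k) E]
    {e r : ℤ} (he : 0 < e) (hr : 0 < r) :
    LinearIndependent K fun ts : {f : Fin l → ℤ // StrictAnti f} => wedge e r l ts.1 := by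
  set φ : MvPolynomial (Fin l) k[X] →+* F :=
    (algebraMap (MvPolynomial (Fin l) K) F).comp (MvPolynomial.map (algebraMap k[X] K)) with hφ
  set ψ : MvPolynomial (Fin l) k[X] →+* E :=
    (algebraMap (MvPolynomial (Fin l) k) E).comp (MvPolynomial.map (evalRingHom 1)) with hψ
  have hinj : Function.Injective φ := by
    rw [hφ, RingHom.coe_comp]
    exact (FaithfulSMul.algebraMap_injective _ _).comp
      (MvPolynomial.map_injective _ (FaithfulSMul.algebraMap_injective _ _))
  have hX (i : Fin l) : (funVar K F i, funVar k E i) ∈ specRing φ ψ := by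
    have h1 := map_mem_specRing (φ := φ) (ψ := ψ) (MvPolynomial.X i)
    simp only [hφ, hψ, RingHom.comp_apply, MvPolynomial.map_X] at h1
    exact h1
  have hC (P : k[X]) :
      (algebraMap K F (algebraMap k[X] K P), algebraMap k E (P.eval 1)) ∈ specRing φ ψ := by
    have h1 := map_mem_specRing (φ := φ) (ψ := ψ) (MvPolynomial.C P)
    simp only [hφ, hψ, RingHom.comp_apply, MvPolynomial.map_C, coe_evalRingHom] at h1
    rw [IsScalarTower.algebraMap_apply K (MvPolynomial (Fin l) K) F,
      IsScalarTower.algebraMap_apply k (MvPolynomial (Fin l) k) E]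
    exact h1
  have hq : (algebraMap K F qK, 1) ∈ specRing φ ψ := by
    have h1 := hC X
    rwa [hqX, eval_X, map_one] at h1
  refine linearIndependent_wedge_of_symmetrizer (σ := permVars K F l) (z := funVar K F)
    permVars_funVar funVar_injective funVar_ne_zero he hr ?_
  refine linearIndependent_symmetrizer_siteOp (k := k) (τ := permVars k E l) he hr
    (fun _ => eq_zero_of_mem_specRing hinj) hC hq ?_ ?_ ?_
    (fun i => zpow_mem_specRing hinj (hX i) (funVar_ne_zero i)) permVars_funVar
    linearIndependent_laurent_monomials
  · have h1 := inv_mem_specRing hinj hq one_ne_zero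
    rwa [← map_inv₀, inv_one] at h1
  · intro g x x' hx
    refine apply_mem_specRing (f := (permVars K F l g : F →+* F))
      (g := (permVars k E l g : E →+* E))
      ((MvPolynomial.rename g : MvPolynomial (Fin l) k[X] →ₐ[k[X]] _) : _ →+* _) ?_ ?_ hx
    · intro p
      simp [hφ, permVars_algebraMap, MvPolynomial.map_rename]
    · intro p
      simp [hψ, permVars_algebraMap, MvPolynomial.map_rename]
  · intro i j hij
    have h1 := inv_mem_specRing hinj ((specRing φ ψ).sub_mem (hX i) (hX j))
      (sub_ne_zero.2 (funVar_injective.ne hij))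
    simpa only [div_eq_mul_inv, Prod.mk_mul_mk] using (specRing φ ψ).mul_mem (hX i) h1

lemma linearIndependent_ordered_wedges {e r : ℤ} (he : 0 < e) (hr : 0 < r) (l : ℕ) :
    LinearIndependent K fun ts : {f : Fin l → ℤ // StrictAnti f} => wedge e r l ts.1 :=
  linearIndependent_wedge_of_fields (k := ℚ) (F := FractionRing (MvPolynomial (Fin l) K))
    (E := FractionRing (MvPolynomial (Fin l) ℚ)) RatFunc.algebraMap_X he hr

end Independence

/-- For `e ≥ 2`, `r' ≥ 1` and `l ≥ 1`, the images of the ordered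
wedges (indexed by strictly decreasing `l`-tuples) form a basis of the `l`-wedge space
`Λ^l_{e,r'}`: they are linearly independent and they span. -/
theorem ordered_wedges_basis (e r : ℤ) (he : 2 ≤ e) (hr : 1 ≤ r) (l : ℕ) (hl : 1 ≤ l) :
    LinearIndependent K
        (fun ts : {f : Fin l → ℤ // StrictAnti f} => wedge e r l ts.1) ∧
      Submodule.span K
        (Set.range fun ts : {f : Fin l → ℤ // StrictAnti f} => wedge e r l ts.1) = ⊤ := by
  exact ⟨linearIndependent_ordered_wedges (by omega) (by omega) l,
    span_ordered_wedges (mul_pos (by omega) (by omega)) l⟩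

end
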